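/- arXiv:1311.5667 — 2 statements merged into one kernel-verified Lean document; each statement's English description precedes it below -/
import Mathlib

section
/- Leading-order form, Case I-1 with m = 2m' > 0: if m = 2m' is a positive even integer and ε = δ = 1, then lim_{Δr→0⁺} Δr^{2−m}·⟨A⟩(Δr) = (D·Ĉ(ρ₀(r))/2^{m−3}) · ( X_{0,1}^m + X_{1,0}^m + β·Σ_{p=1}^{m'−1} C(m,2p)·X_{1,0}^{2p}·X_{0,1}^{2(m'−p)} ), where X_{1,0} := (v/D)·ρ₀(r), X_{0,1} := −(v/D)·ρ₀(r) + ρ₀'(r), C(m,j) is the binomial coefficient, and the sum is empty (equal to 0) when m' = 1. -/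
open Filter Finset

noncomputable section

/-- Transition probability η on trits: η(0) = (β/2)(1 − Pe/2), η(1) = 1 − β,
η(2) = (β/2)(1 + Pe/2). -/
def eta (β Pe : ℝ) (ω : Fin 3) : ℝ :=
  if (ω : ℕ) = 0 then β / 2 * (1 - Pe / 2)
  else if (ω : ℕ) = 1 then 1 - β
  else β / 2 * (1 + Pe / 2)

/-- ν(ω) = η(2 − ω). -/
def nu (β Pe : ℝ) (ω : Fin 3) : ℝ :=
  if (ω : ℕ) = 0 then β / 2 * (1 + Pe / 2)
  else if (ω : ℕ) = 1 then 1 - β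
  else β / 2 * (1 - Pe / 2)

/-- Bulk local density ρ̂ⱼ(u′) = (∏ η(u_d)/ν(u_d)) · ρ₀(r + (j + Σ (1 − u_d))·Δr). -/
def rhoHat (β Pe r Δr : ℝ) (ρ₀ : ℝ → ℝ) {K : ℕ} (j : ℤ) (u : Fin K → Fin 3) : ℝ :=
  (∏ d, eta β Pe (u d) / nu β Pe (u d)) *
    ρ₀ (r + ((j : ℝ) + ∑ d, (1 - ((u d : ℕ) : ℝ))) * Δr)

/-- F_j(ω, u) with u = u₀u′ :
F_j(ω,u) = f((η(ω)/ν(ω))·ρ̂_j(u′), (η(u₀)/ν(u₀))·ρ̂_{j+1−u₀}(u′)). -/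
def Floc (β Pe r Δr : ℝ) (ρ₀ : ℝ → ℝ) (f : ℝ → ℝ → ℝ) {K : ℕ}
    (j : ℤ) (ω u₀ : Fin 3) (u' : Fin K → Fin 3) : ℝ :=
  f (eta β Pe ω / nu β Pe ω * rhoHat β Pe r Δr ρ₀ j u')
    (eta β Pe u₀ / nu β Pe u₀ * rhoHat β Pe r Δr ρ₀ (j + 1 - ((u₀ : ℕ) : ℤ)) u')

/-- K(Δr): the sum over the trit ω and the k-digit trit string u = u₀u′. -/
def Ksum (D v β r : ℝ) (k : ℕ) (ρ₀ : ℝ → ℝ) (f : ℝ → ℝ → ℝ)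
    (ε δ : ℝ) (m : ℕ) (Δr : ℝ) : ℝ :=
  Δr * ∑ ω : Fin 3, ∑ u₀ : Fin 3, ∑ u' : Fin (k - 1) → Fin 3,
    (eta β (v * Δr / D) ω + δ * nu β (v * Δr / D) ω) *
      (nu β (v * Δr / D) u₀ * ∏ d, nu β (v * Δr / D) (u' d)) *
      (Floc β (v * Δr / D) r Δr ρ₀ f 0 ω u₀ u' +
        ε * (-1 : ℝ) ^ m * Floc β (v * Δr / D) r Δr ρ₀ f (1 - ((ω : ℕ) : ℤ)) ω u₀ u')

/-- The spatio-temporally averaged T¹-type quantity ⟨A⟩(Δr) = K/(τ·Δr),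
with τ = β·Δr²/(2D). -/
def avgA (D v β r : ℝ) (k : ℕ) (ρ₀ : ℝ → ℝ) (f : ℝ → ℝ → ℝ)
    (ε δ : ℝ) (m : ℕ) (Δr : ℝ) : ℝ :=
  Ksum D v β r k ρ₀ f ε δ m Δr / (β * Δr ^ 2 / (2 * D) * Δr)

/-- f̃(X,Y) = f(Y + X, Y − X). -/
def ftilde (f : ℝ → ℝ → ℝ) (X Y : ℝ) : ℝ := f (Y + X) (Y - X)

/-- Partial derivatives in the first variable of a jointly smooth function are jointly smooth. -/
theorem contDiff_uncurry_iteratedDeriv_fst {g : ℝ → ℝ → ℝ}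
    (hg : ContDiff ℝ (⊤ : ℕ∞) (Function.uncurry g)) (n : ℕ) :
    ContDiff ℝ (⊤ : ℕ∞) (fun p : ℝ × ℝ => iteratedDeriv n (fun X => g X p.2) p.1) := by
  induction n with
  | zero => simp only [iteratedDeriv_zero]; exact hg
  | succ n ih =>
    have hfd : ContDiff ℝ (⊤ : ℕ∞) (fun p : ℝ × ℝ =>
        fderiv ℝ (fun q : ℝ × ℝ => iteratedDeriv n (fun X => g X q.2) q.1) p (1, 0)) :=
      (ih.fderiv_right (m := (⊤ : ℕ∞)) (by simp)).clm_apply contDiff_const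
    convert hfd using 2 with p
    rw [iteratedDeriv_succ]
    have hd := ((ih.differentiable (by simp)) (p.1, p.2)).hasFDerivAt
    have hl : HasDerivAt (fun X : ℝ => (X, p.2)) ((1 : ℝ), (0 : ℝ)) p.1 :=
      (hasDerivAt_id p.1).prodMk (hasDerivAt_const p.1 p.2)
    exact (hd.comp_hasDerivAt p.1 hl).deriv

/-- Lagrange remainder for a function whose derivatives of order below `m` vanish at `0`. -/
theorem exists_eq_iteratedDeriv_mul_pow_div_factorial {h : ℝ → ℝ} {m : ℕ} (hm : 0 < m)
    (hh : ContDiff ℝ (⊤ : ℕ∞) h) (hlow : ∀ j < m, iteratedDeriv j h 0 = 0) (x : ℝ) :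
    ∃ ξ, |ξ| ≤ |x| ∧ h x = iteratedDeriv m h ξ * x ^ m / (m.factorial : ℝ) := by
  obtain ⟨n, rfl⟩ : ∃ n, m = n + 1 := ⟨m - 1, by omega⟩
  rcases eq_or_ne 0 x with rfl | hx
  · exact ⟨0, le_rfl, by simpa using hlow 0 (by omega)⟩
  · obtain ⟨ξ, hξ, he⟩ := taylor_mean_remainder_lagrange_iteratedDeriv (n := n) hx
      ((hh.of_le (by exact_mod_cast le_top)).contDiffOn)
    refine ⟨ξ, ?_, ?_⟩
    · have := Set.uIoo_subset_uIcc_self hξ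
      simpa using Set.abs_sub_left_of_mem_uIcc this
    · have h0 : taylorWithinEval h n (Set.uIcc 0 x) 0 x = 0 := by
        rw [taylor_within_apply]
        refine Finset.sum_eq_zero fun j hj => ?_
        rw [iteratedDerivWithin_eq_iteratedDeriv (uniqueDiffOn_uIcc hx)
          ((hh.of_le (by exact_mod_cast le_top)).contDiffAt) (by simp),
          hlow j (by simpa using hj), smul_zero]
      simpa [h0] using he

/-- Along a curve approaching the diagonal with slope `L`, a function vanishing on the diagonal
to order `m` is asymptotic to its leading coefficient times `(t * L / 2) ^ m`. -/
theorem tendsto_div_pow_of_iteratedDeriv_ftilde {f : ℝ → ℝ → ℝ} {m : ℕ} {Chat : ℝ → ℝ}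
    (hm : 0 < m) (hf : ContDiff ℝ (⊤ : ℕ∞) (Function.uncurry f))
    (hlow : ∀ Y : ℝ, ∀ j < m, iteratedDeriv j (fun X => ftilde f X Y) 0 = 0)
    (hchar : ∀ Y : ℝ, iteratedDeriv m (fun X => ftilde f X Y) 0 = (m.factorial : ℝ) * Chat Y)
    {l : Filter ℝ} {x y : ℝ → ℝ} {c L : ℝ} (hne : ∀ᶠ t in l, t ≠ 0)
    (hx : Tendsto x l (nhds c)) (hy : Tendsto y l (nhds c))
    (hxy : Tendsto (fun t => (x t - y t) / t) l (nhds L)) :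
    Tendsto (fun t => f (x t) (y t) / t ^ m) l (nhds (Chat c * (L / 2) ^ m)) := by
  have hft : ContDiff ℝ (⊤ : ℕ∞) (Function.uncurry (ftilde f)) :=
    hf.comp ((contDiff_snd.add contDiff_fst).prodMk (contDiff_snd.sub contDiff_fst))
  have hslice (Y : ℝ) : ContDiff ℝ (⊤ : ℕ∞) (fun X => ftilde f X Y) :=
    hft.comp (contDiff_id.prodMk contDiff_const)
  choose ξ hξ he using fun t => exists_eq_iteratedDeriv_mul_pow_div_factorial hm
    (hslice ((x t + y t) / 2)) (hlow _) ((x t - y t) / 2)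
  have hX : Tendsto (fun t => (x t - y t) / 2) l (nhds 0) := by
    simpa using (hx.sub hy).div_const 2
  have hξ0 : Tendsto ξ l (nhds 0) :=
    squeeze_zero_norm hξ (by simpa using hX.abs)
  have hY : Tendsto (fun t => (x t + y t) / 2) l (nhds c) := by
    simpa using (hx.add hy).div_const 2
  have hG := ((contDiff_uncurry_iteratedDeriv_fst hft m).continuous.tendsto (0, c)).comp
    (hξ0.prodMk_nhds hY)
  have hmain := (hG.mul ((hxy.div_const 2).pow m)).div_const (m.factorial : ℝ)
  simp only [hchar] at hmain
  have hfac : (m.factorial : ℝ) ≠ 0 := by positivity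
  have hlim : (m.factorial : ℝ) * Chat c * (L / 2) ^ m / (m.factorial : ℝ)
      = Chat c * (L / 2) ^ m := by field_simp
  rw [hlim] at hmain
  refine hmain.congr' ?_
  filter_upwards [hne] with t ht
  have hval : f (x t) (y t) = ftilde f ((x t - y t) / 2) ((x t + y t) / 2) := by
    unfold ftilde; congr 1 <;> ring
  rw [hval, he t]
  simp only [Function.comp, div_pow]
  field_simp

theorem hasDerivAt_eta_div_nu {D v β : ℝ} (hβ0 : 0 < β) (hβ1 : β < 1) (ω : Fin 3) :
    HasDerivAt (fun t : ℝ => eta β (v * t / D) ω / nu β (v * t / D) ω)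
      ((((ω : ℕ) : ℝ) - 1) * (v / D)) 0 := by
  have hPe : HasDerivAt (fun t : ℝ => v * t / D / 2) (v / D / 2) 0 := by
    simpa using (((hasDerivAt_id (0 : ℝ)).const_mul v).div_const D).div_const 2
  have hp := (hPe.const_add 1).const_mul (β / 2)
  have hn := (hPe.const_sub 1).const_mul (β / 2)
  fin_cases ω
  · simp only [eta, nu]
    convert! hn.div hp (by simp [hβ0.ne']) using 1
    simp; field_simp; ring
  · have h1 : (1 - β) ≠ 0 := by linarith
    simpa [eta, nu, h1] using hasDerivAt_const (0 : ℝ) (1 : ℝ)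
  · simp only [eta, nu]
    convert! hp.div hn (by simp [hβ0.ne']) using 1
    simp; field_simp; ring

theorem eta_div_nu_zero {β : ℝ} (hβ0 : 0 < β) (hβ1 : β < 1) (ω : Fin 3) :
    eta β 0 ω / nu β 0 ω = 1 := by
  have h1 : (1 - β) ≠ 0 := by linarith
  fin_cases ω <;> simp [eta, nu, h1, hβ0.ne']

theorem tendsto_eta (D v β : ℝ) (ω : Fin 3) :
    Tendsto (fun t : ℝ => eta β (v * t / D) ω) (nhds 0) (nhds (eta β 0 ω)) := by
  have h : Continuous (fun t : ℝ => eta β (v * t / D) ω) := by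
    unfold eta; split_ifs <;> fun_prop
  simpa using h.tendsto 0

theorem tendsto_nu (D v β : ℝ) (ω : Fin 3) :
    Tendsto (fun t : ℝ => nu β (v * t / D) ω) (nhds 0) (nhds (nu β 0 ω)) := by
  have h : Continuous (fun t : ℝ => nu β (v * t / D) ω) := by
    unfold nu; split_ifs <;> fun_prop
  simpa using h.tendsto 0

/-- Leading-order behaviour of `Floc`, which depends neither on `j` nor on `u'`. -/
theorem tendsto_Floc_div_pow {D v β r : ℝ} {ρ₀ : ℝ → ℝ} {f : ℝ → ℝ → ℝ} {m : ℕ} {Chat : ℝ → ℝ}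
    (hβ0 : 0 < β) (hβ1 : β < 1) (hρ : ContDiff ℝ (⊤ : ℕ∞) ρ₀) (hm : 0 < m)
    (hf : ContDiff ℝ (⊤ : ℕ∞) (Function.uncurry f))
    (hlow : ∀ Y : ℝ, ∀ j < m, iteratedDeriv j (fun X => ftilde f X Y) 0 = 0)
    (hchar : ∀ Y : ℝ, iteratedDeriv m (fun X => ftilde f X Y) 0 = (m.factorial : ℝ) * Chat Y)
    {K : ℕ} (j : ℤ) (ω u₀ : Fin 3) (u' : Fin K → Fin 3) :
    Tendsto (fun t : ℝ => Floc β (v * t / D) r t ρ₀ f j ω u₀ u' / t ^ m)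
      (nhdsWithin 0 (Set.Ioi 0))
      (nhds (Chat (ρ₀ r) * (((((ω : ℕ) : ℝ) - 1) * (v / D * ρ₀ r) +
        (((u₀ : ℕ) : ℝ) - 1) * (-(v / D) * ρ₀ r + deriv ρ₀ r)) / 2) ^ m)) := by
  have hA (w : Fin 3) (a : ℝ) : HasDerivAt
      (fun t : ℝ => eta β (v * t / D) w / nu β (v * t / D) w * ρ₀ (r + a * t))
      ((((w : ℕ) : ℝ) - 1) * (v / D) * ρ₀ r + deriv ρ₀ r * a) 0 := by
    have hi : HasDerivAt (fun t : ℝ => r + a * t) a 0 := by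
      simpa using ((hasDerivAt_id (0 : ℝ)).const_mul a).const_add r
    have hd : HasDerivAt ρ₀ (deriv ρ₀ r) (r + a * 0) := by
      simpa using ((hρ.differentiable (by simp)) r).hasDerivAt
    have h := (hasDerivAt_eta_div_nu (D := D) (v := v) hβ0 hβ1 w).mul (hd.comp 0 hi)
    simp only [mul_zero, zero_div, eta_div_nu_zero hβ0 hβ1, one_mul, Function.comp_apply,
      add_zero] at h
    exact h
  have hP : Tendsto (fun t : ℝ => ∏ d, eta β (v * t / D) (u' d) / nu β (v * t / D) (u' d))
      (nhdsWithin 0 (Set.Ioi 0)) (nhds 1) := by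
    have := tendsto_finsetProd (Finset.univ : Finset (Fin K)) fun d _ =>
      (hasDerivAt_eta_div_nu (D := D) (v := v) hβ0 hβ1 (u' d)).continuousAt.tendsto
    simp only [mul_zero, zero_div, eta_div_nu_zero hβ0 hβ1, Finset.prod_const_one] at this
    exact this.mono_left nhdsWithin_le_nhds
  have hlim (w : Fin 3) (a : ℝ) : Tendsto (fun t : ℝ =>
      (∏ d, eta β (v * t / D) (u' d) / nu β (v * t / D) (u' d)) *
      (eta β (v * t / D) w / nu β (v * t / D) w * ρ₀ (r + a * t)))
      (nhdsWithin 0 (Set.Ioi 0)) (nhds (ρ₀ r)) := by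
    have := hP.mul ((hA w a).continuousAt.tendsto.mono_left nhdsWithin_le_nhds)
    simpa [eta_div_nu_zero hβ0 hβ1] using this
  set s : ℝ := ∑ d, (1 - ((u' d : ℕ) : ℝ)) with hs
  have hslope := (hA ω (j + s)).sub (hA u₀ (j + 1 - ((u₀ : ℕ) : ℝ) + s))
  have hslope' := hslope.tendsto_slope_zero_right
  have hsl := hP.mul hslope'
  have hF := tendsto_div_pow_of_iteratedDeriv_ftilde hm hf hlow hchar
    (l := nhdsWithin 0 (Set.Ioi 0)) (L := (((ω : ℕ) : ℝ) - 1) * (v / D * ρ₀ r) +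
        (((u₀ : ℕ) : ℝ) - 1) * (-(v / D) * ρ₀ r + deriv ρ₀ r))
    (by filter_upwards [self_mem_nhdsWithin] with t ht using ne_of_gt ht)
    (hlim ω (j + s)) (hlim u₀ (j + 1 - ((u₀ : ℕ) : ℝ) + s)) (by
      convert hsl using 2 with t
      · simp [eta_div_nu_zero hβ0 hβ1]
        ring
      · ring)
  refine hF.congr fun t => ?_
  simp only [Floc, rhoHat, ← hs]
  push_cast
  congr 2 <;> ring

/-- Summing the even-indexed terms of a range. -/
theorem sum_range_mul_one_add_neg_one_pow (g : ℕ → ℝ) (n : ℕ) :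
    ∑ i ∈ Finset.range (2 * n + 1), (1 + (-1) ^ i) * g i =
      2 * ∑ p ∈ Finset.range (n + 1), g (2 * p) := by
  induction n with
  | zero => norm_num
  | succ n ih =>
    rw [show 2 * (n + 1) + 1 = 2 * n + 1 + 1 + 1 by ring, Finset.sum_range_succ,
      Finset.sum_range_succ, ih, Finset.sum_range_succ _ (n + 1)]
    have hodd : (-1 : ℝ) ^ (2 * n + 1) = -1 := by simp [pow_succ, pow_mul]
    have heven : (-1 : ℝ) ^ (2 * n + 1 + 1) = 1 := by rw [pow_succ, hodd]; norm_num
    rw [hodd, heven, show 2 * (n + 1) = 2 * n + 1 + 1 by ring]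
    ring

theorem add_pow_add_sub_pow_even (X Y : ℝ) {n : ℕ} (hn : 0 < n) :
    (X + Y) ^ (2 * n) + (-X + Y) ^ (2 * n) = 2 * (Y ^ (2 * n) + X ^ (2 * n) +
      ∑ p ∈ Finset.Icc 1 (n - 1),
        ((2 * n).choose (2 * p) : ℝ) * X ^ (2 * p) * Y ^ (2 * (n - p))) := by
  have hsum : (X + Y) ^ (2 * n) + (-X + Y) ^ (2 * n) = 2 * ∑ p ∈ Finset.range (n + 1),
      ((2 * n).choose (2 * p) : ℝ) * X ^ (2 * p) * Y ^ (2 * n - 2 * p) := by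
    rw [← sum_range_mul_one_add_neg_one_pow
      (fun i => ((2 * n).choose i : ℝ) * X ^ i * Y ^ (2 * n - i)), add_pow, add_pow,
      ← Finset.sum_add_distrib]
    refine Finset.sum_congr rfl fun i _ => ?_
    rw [neg_pow X i]
    ring
  obtain ⟨k, rfl⟩ : ∃ k, n = k + 1 := ⟨n - 1, by omega⟩
  rw [hsum, Finset.sum_range_succ, Finset.sum_range_succ', Nat.add_sub_cancel,
    Finset.range_eq_Ico, Finset.sum_Ico_add' (fun p => ((2 * (k + 1)).choose (2 * p) : ℝ) *
      X ^ (2 * p) * Y ^ (2 * (k + 1) - 2 * p)) 0 k 1]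
  have hIcc : Finset.Ico (0 + 1) (k + 1) = Finset.Icc 1 k := by ext; simp
  simp only [hIcc, Nat.mul_sub]
  simp
  ring

theorem sum_nu_zero (β : ℝ) : ∑ ω : Fin 3, nu β 0 ω = 1 := by
  simp [Fin.sum_univ_three, nu]
  ring

theorem sum_prod_nu_zero (β : ℝ) (K : ℕ) :
    ∑ u : Fin K → Fin 3, ∏ d, nu β 0 (u d) = 1 := by
  have h := Finset.sum_prod_piFinset (Finset.univ : Finset (Fin 3))
    (fun (_ : Fin K) ω => nu β 0 ω)
  simpa [sum_nu_zero] using h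

/-- The even moments of `a * X + b * Y` for independent symmetric steps `a, b ∈ {-1, 0, 1}`. -/
theorem sum_eta_nu_mul_pow (β X Y : ℝ) {n : ℕ} (hn : 0 < n) :
    ∑ ω : Fin 3, ∑ u₀ : Fin 3, eta β 0 ω * nu β 0 u₀ *
      ((((ω : ℕ) : ℝ) - 1) * X + (((u₀ : ℕ) : ℝ) - 1) * Y) ^ (2 * n) =
    β * (Y ^ (2 * n) + X ^ (2 * n) + β * ∑ p ∈ Finset.Icc 1 (n - 1),
        ((2 * n).choose (2 * p) : ℝ) * X ^ (2 * p) * Y ^ (2 * (n - p))) := by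
  have h := add_pow_add_sub_pow_even X Y hn
  have hev (z : ℝ) : (-z) ^ (2 * n) = z ^ (2 * n) := (even_two_mul n).neg_pow z
  have h1 : (-X + -Y) ^ (2 * n) = (X + Y) ^ (2 * n) := by rw [← hev]; ring_nf
  have h2 : (X + -Y) ^ (2 * n) = (-X + Y) ^ (2 * n) := by rw [← hev]; ring_nf
  have h0 : (0 : ℝ) ^ (2 * n) = 0 := zero_pow (by omega)
  have h21 : (2 : ℝ) - 1 = 1 := by norm_num
  simp only [Fin.sum_univ_three, eta, nu, Fin.val_zero, Fin.val_one, Fin.val_two, Nat.cast_zero,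
    Nat.cast_one, Nat.cast_ofNat, zero_sub, sub_self, h21, one_mul, neg_one_mul, zero_mul,
    zero_add, add_zero, zero_div, sub_zero, h1, h2, h0, hev]
  simp
  linear_combination (β ^ 2 / 2) * h

/-- Leading-order form, Case I-1 with m = 2m′ > 0 and ε = δ = 1:
lim_{Δr→0⁺} Δr^(2−m)·⟨A⟩(Δr)
  = (D·Ĉ(ρ)/2^(m−3))·(X₀₁^m + X₁₀^m + β·Σ_{p=1}^{m′−1} C(m,2p)·X₁₀^(2p)·X₀₁^(2(m′−p))),
with X₁₀ = (v/D)ρ₀(r), X₀₁ = −(v/D)ρ₀(r) + ρ₀′(r). -/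
theorem leading_form_I1_m_pos
    (D v β r : ℝ) (k : ℕ) (ρ₀ : ℝ → ℝ) (f : ℝ → ℝ → ℝ)
    (ε δ : ℝ) (m : ℕ) (Chat : ℝ → ℝ)
    (hD : 0 < D) (hβ0 : 0 < β) (hβ1 : β < 1) (hk : 1 ≤ k)
    (hρ : ContDiff ℝ (⊤ : ℕ∞) ρ₀) (hρpos : ∀ x, 0 < ρ₀ x)
    (hf : ContDiff ℝ (⊤ : ℕ∞) (Function.uncurry f))
    (hε : ε = 1 ∨ ε = -1) (hδ : δ = 1 ∨ δ = -1)
    (hsym : ∀ x y, f y x = (-1 : ℝ) ^ m * f x y)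
    (hlow : ∀ Y : ℝ, ∀ j < m, iteratedDeriv j (fun X => ftilde f X Y) 0 = 0)
    (hchar : ∀ Y : ℝ, iteratedDeriv m (fun X => ftilde f X Y) 0 = (m.factorial : ℝ) * Chat Y)
    (hCbdd : ∃ M : ℝ, ∀ y, |Chat y| ≤ M) (hCne : ∀ y, Chat y ≠ 0)
    (m' : ℕ) (hm : m = 2 * m') (hm' : 0 < m') (hε1 : ε = 1) (hδ1 : δ = 1) :
    Filter.Tendsto
      (fun Δr : ℝ => Δr ^ ((2 : ℤ) - (m : ℤ)) * avgA D v β r k ρ₀ f ε δ m Δr)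
      (nhdsWithin 0 (Set.Ioi 0))
      (nhds (D * Chat (ρ₀ r) / (2 : ℝ) ^ ((m : ℤ) - 3) *
        ((-(v / D) * ρ₀ r + deriv ρ₀ r) ^ m + (v / D * ρ₀ r) ^ m +
          β * ∑ p ∈ Finset.Icc 1 (m' - 1),
            (m.choose (2 * p) : ℝ) * (v / D * ρ₀ r) ^ (2 * p) *
              (-(v / D) * ρ₀ r + deriv ρ₀ r) ^ (2 * (m' - p))))) := by
  subst hε1 hδ1
  have hm0 : 0 < m := by omega
  have hsgn : (-1 : ℝ) ^ m = 1 := by rw [hm]; simp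
  set X := v / D * ρ₀ r
  set Y := -(v / D) * ρ₀ r + deriv ρ₀ r
  set C := Chat (ρ₀ r)
  let S := nhdsWithin (0 : ℝ) (Set.Ioi 0)
  have hterm (ω u₀ : Fin 3) (u' : Fin (k - 1) → Fin 3) :
      Tendsto (fun t : ℝ => (eta β (v * t / D) ω + nu β (v * t / D) ω) *
        (nu β (v * t / D) u₀ * ∏ d, nu β (v * t / D) (u' d)) *
        (Floc β (v * t / D) r t ρ₀ f 0 ω u₀ u' / t ^ m +
          Floc β (v * t / D) r t ρ₀ f (1 - ((ω : ℕ) : ℤ)) ω u₀ u' / t ^ m)) S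
      (nhds ((eta β 0 ω + nu β 0 ω) * (nu β 0 u₀ * ∏ d, nu β 0 (u' d)) *
        (C * (((((ω : ℕ) : ℝ) - 1) * X + (((u₀ : ℕ) : ℝ) - 1) * Y) / 2) ^ m +
          C * (((((ω : ℕ) : ℝ) - 1) * X + (((u₀ : ℕ) : ℝ) - 1) * Y) / 2) ^ m))) := by
    have hw := ((tendsto_eta D v β ω).add (tendsto_nu D v β ω)).mul
      ((tendsto_nu D v β u₀).mul
        (tendsto_finsetProd Finset.univ fun d _ => tendsto_nu D v β (u' d)))
    exact (hw.mono_left nhdsWithin_le_nhds).mul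
      ((tendsto_Floc_div_pow hβ0 hβ1 hρ hm0 hf hlow hchar 0 ω u₀ u').add
        (tendsto_Floc_div_pow hβ0 hβ1 hρ hm0 hf hlow hchar _ ω u₀ u'))
  have hsum := (tendsto_finsetSum Finset.univ fun ω _ => tendsto_finsetSum Finset.univ
    fun u₀ _ => tendsto_finsetSum Finset.univ fun u' _ => hterm ω u₀ u').const_mul (2 * D / β)
  have heta (ω : Fin 3) : nu β 0 ω = eta β 0 ω := by simp [eta, nu]
  have hlim : 2 * D / β * (∑ ω : Fin 3, ∑ u₀ : Fin 3, ∑ u' : Fin (k - 1) → Fin 3,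
      (eta β 0 ω + nu β 0 ω) * (nu β 0 u₀ * ∏ d, nu β 0 (u' d)) *
        (C * (((((ω : ℕ) : ℝ) - 1) * X + (((u₀ : ℕ) : ℝ) - 1) * Y) / 2) ^ m +
          C * (((((ω : ℕ) : ℝ) - 1) * X + (((u₀ : ℕ) : ℝ) - 1) * Y) / 2) ^ m)) =
      D * C / (2 : ℝ) ^ ((m : ℤ) - 3) * (Y ^ m + X ^ m + β * ∑ p ∈ Finset.Icc 1 (m' - 1),
        (m.choose (2 * p) : ℝ) * X ^ (2 * p) * Y ^ (2 * (m' - p))) := by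
    have hinner (ω u₀ : Fin 3) : ∑ u' : Fin (k - 1) → Fin 3,
        (eta β 0 ω + nu β 0 ω) * (nu β 0 u₀ * ∏ d, nu β 0 (u' d)) *
        (C * (((((ω : ℕ) : ℝ) - 1) * X + (((u₀ : ℕ) : ℝ) - 1) * Y) / 2) ^ m +
          C * (((((ω : ℕ) : ℝ) - 1) * X + (((u₀ : ℕ) : ℝ) - 1) * Y) / 2) ^ m) =
        4 * C / 2 ^ m * (eta β 0 ω * nu β 0 u₀ *
          ((((ω : ℕ) : ℝ) - 1) * X + (((u₀ : ℕ) : ℝ) - 1) * Y) ^ m) := by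
      rw [← Finset.sum_mul, ← Finset.mul_sum, ← Finset.mul_sum, sum_prod_nu_zero, heta ω, div_pow]
      ring
    have hmom := sum_eta_nu_mul_pow β X Y hm'
    rw [← hm] at hmom
    simp only [hinner, ← Finset.mul_sum]
    rw [hmom, zpow_sub₀ two_ne_zero, zpow_natCast]
    field_simp
    norm_num
  rw [hlim] at hsum
  refine hsum.congr' ?_
  filter_upwards [self_mem_nhdsWithin] with t ht
  have ht0 : t ≠ 0 := ne_of_gt ht
  simp only [avgA, Ksum, hsgn, one_mul, ← add_div, ← mul_div_assoc, ← Finset.sum_div]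
  rw [zpow_sub₀ ht0, zpow_natCast, zpow_ofNat]
  field_simp
end
end

section
/- Leading-order form, Case I-2: if m = 2m' is an even nonnegative integer (m' ≥ 0) and (ε,δ) ≠ (1,1), then lim_{Δr→0⁺} Δr^{−m}·⟨A⟩(Δr) = L, where L := β·((1+ε)(δ−1)/2^{m+1})·(v²·Ĉ(ρ)/D)·Σ_{p=0}^{m'−1} C(m,2p+1)·X_{1,0}^{2p+1}·X_{0,1}^{2(m'−p)−1} − (v/2^{m+1})·Ĉ_ρ(ρ)·{ Σ_{p=0}^{m'} C(m,2p)·X_{1,0}^{2p}·X_{0,1}^{2(m'−p)}·[ (δ+1)·Y^{(1)}_{0,1}·S_ν(2p) + (δ−1)·Y^{(1)}_{1,0}·S_ν(2(m'−p)) + ε·( (δ+1)·Y^{(2)}_{0,1}·S_ν(2p) + (δ−1)·Y^{(2)}_{1,0}·S_ν(2(m'−p)) ) ] + β·Σ_{p=0}^{m'−1} C(m,2p+1)·X_{1,0}^{2p+1}·X_{0,1}^{2(m'−p)−1}·[ (δ−1)·Y^{(1)}_{0,1} + (δ+1)·Y^{(1)}_{1,0} + ε·( (δ−1)·Y^{(2)}_{0,1}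 + (δ+1)·Y^{(2)}_{1,0} ) ] } − (m·v/2^{m+1})·Ĉ(ρ)·{ Σ_{p=0}^{m'−1} C(m−1,2p)·X_{1,0}^{2p}·X_{0,1}^{2(m'−p)−1}·[ (δ+1)·X^{(1)}_{0,2}·S_ν(2p) + β(δ−1)·X^{(1)}_{1,1} + β(δ+1)·X^{(1)}_{2,0} + ε·( (δ+1)·X^{(2)}_{0,2}·S_ν(2p) + β(δ−1)·X^{(2)}_{1,1} + β(δ+1)·X^{(2)}_{2,0} ) ] + Σ_{p=0}^{m'−1} C(m−1,2p+1)·X_{1,0}^{2p+1}·X_{0,1}^{2(m'−p−1)}·[ β(δ−1)·X^{(1)}_{0,2} + β(δ+1)·X^{(1)}_{1,1} + (δ−1)·X^{(1)}_{2,0}·S_ν(2(m'−p−1)) + ε·( β(δ−1)·X^{(2)}_{0,2} + β(δ+1)·X^{(2)}_{1,1} + (δ−1)·X^{(2)}_{2,0}·S_ν(2(m'−p−1)) ) ] } + (δ+1)·(D/2^{m+1})·{ Σ_{p=0}^{m'} C(m,2p)·X_{1,0}^{2p}·X_{0,1}^{2(m'−p)}·[ Ĉ_ρ(ρ)·( Y^{(1)}_{0,2}·S_ν(2p)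 + Y^{(1)}_{2,0}·S_ν(2(m'−p)) + ε·( Y^{(2)}_{0,2}·S_ν(2p) + Y^{(2)}_{2,0}·S_ν(2(m'−p)) ) ) + (1/2)·Ĉ_ρρ(ρ)·( (Y^{(1)}_{0,1})²·S_ν(2p) + (Y^{(1)}_{1,0})²·S_ν(2(m'−p)) + ε·( (Y^{(2)}_{0,1})²·S_ν(2p) + (Y^{(2)}_{1,0})²·S_ν(2(m'−p)) ) ) ] + β·Σ_{p=0}^{m'−1} C(m,2p+1)·X_{1,0}^{2p+1}·X_{0,1}^{2(m'−p)−1}·[ Ĉ_ρ(ρ)·( Y^{(1)}_{1,1} + ε·Y^{(2)}_{1,1} ) + Ĉ_ρρ(ρ)·( Y^{(1)}_{0,1}·Y^{(1)}_{1,0} + ε·Y^{(2)}_{0,1}·Y^{(2)}_{1,0} ) ] } + (δ+1)·(m·D/2^{m+1})·{ Σ_{p=0}^{m'−1} C(m−1,2p)·X_{1,0}^{2p}·X_{0,1}^{2(m'−p)−1}·[ Ĉ_ρ(ρ)·( X^{(1)}_{0,2}·Y^{(1)}_{0,1}·S_ν(2p) + β·X^{(1)}_{1,1}·Y^{(1)}_{1,0}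 + β·X^{(1)}_{2,0}·Y^{(1)}_{0,1} + ε·( X^{(2)}_{0,2}·Y^{(2)}_{0,1}·S_ν(2p) + β·X^{(2)}_{1,1}·Y^{(2)}_{1,0} + β·X^{(2)}_{2,0}·Y^{(2)}_{0,1} ) ) + Ĉ(ρ)·( X^{(1)}_{0,3}·S_ν(2p) + β·X^{(1)}_{2,1} + ε·( X^{(2)}_{0,3}·S_ν(2p) + β·X^{(2)}_{2,1} ) ) ] + Σ_{p=0}^{m'−1} C(m−1,2p+1)·X_{1,0}^{2p+1}·X_{0,1}^{2(m'−p−1)}·[ Ĉ_ρ(ρ)·( β·X^{(1)}_{0,2}·Y^{(1)}_{1,0} + β·X^{(1)}_{1,1}·Y^{(1)}_{0,1} + X^{(1)}_{2,0}·Y^{(1)}_{1,0}·S_ν(2(m'−p−1)) + ε·( β·X^{(2)}_{0,2}·Y^{(2)}_{1,0} + β·X^{(2)}_{1,1}·Y^{(2)}_{0,1} + X^{(2)}_{2,0}·Y^{(2)}_{1,0}·S_ν(2(m'−p−1)) ) ) + Ĉ(ρ)·( β·X^{(1)}_{1,2} + X^{(1)}_{3,0}·S_ν(2(m'−p−1))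 + ε·( β·X^{(2)}_{1,2} + X^{(2)}_{3,0}·S_ν(2(m'−p−1)) ) ) ] } + (δ+1)·(m(m−1)/2^{m+2})·D·Ĉ(ρ)·{ Σ_{p=0}^{m'−1} C(m−2,2p)·X_{1,0}^{2p}·X_{0,1}^{2(m'−p−1)}·[ (X^{(1)}_{0,2})²·S_ν(2p) + 2β·X^{(1)}_{0,2}·X^{(1)}_{2,0} + β·(X^{(1)}_{1,1})² + (X^{(1)}_{2,0})²·S_ν(2(m'−p−1)) + ε·( (X^{(2)}_{0,2})²·S_ν(2p) + 2β·X^{(2)}_{0,2}·X^{(2)}_{2,0} + β·(X^{(2)}_{1,1})² + (X^{(2)}_{2,0})²·S_ν(2(m'−p−1)) ) ] + β·Σ_{p=0}^{m'−2} C(m−2,2p+1)·X_{1,0}^{2p+1}·X_{0,1}^{2(m'−p−1)−1}·[ 2·X^{(1)}_{0,2}·X^{(1)}_{1,1} + 2·X^{(1)}_{1,1}·X^{(1)}_{2,0} + ε·( 2·X^{(2)}_{0,2}·X^{(2)}_{1,1} + 2·X^{(2)}_{1,1}·X^{(2)}_{2,0} ) ] }. -/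
open Filter Finset

noncomputable section

set_option linter.unusedVariables false in
/-- The limit value L of Δr^(−m)·⟨A⟩(Δr) in Case I-2 (m = 2m′ even, (ε,δ) ≠ (1,1)),
expressed through the leading-order constants X_{p,q}, Y^{(i)}_{p,q}, S_ν and the
derivatives of Ĉ at ρ = ρ₀(r). -/
def LI2 (D v β r : ℝ) (ρ₀ Chat : ℝ → ℝ) (ε δ : ℝ) (m m' : ℕ) : ℝ :=
  let ρ := ρ₀ r;
  let ρr := deriv ρ₀ r;
  let ρrr := iteratedDeriv 2 ρ₀ r;
  let ρrrr := iteratedDeriv 3 ρ₀ r;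
  let X10 := v / D * ρ;
  let X01 := -(v / D) * ρ + ρr;
  let Y110 := v / D * ρ;
  let Y210 := v / D * ρ - 2 * ρr;
  let Y101 := v / D * ρ - ρr;
  let Y201 := v / D * ρ - ρr;
  let X120 := (v / D) ^ 2 * ρ;
  let X220 := (v / D) ^ 2 * ρ - 2 * (v / D) * ρr;
  let X111 := (0 : ℝ);
  let X211 := 2 * (v / D) * ρr - 2 * ρrr;
  let X102 := -(v / D) ^ 2 * ρ + 2 * (v / D) * ρr - ρrr;
  let X202 := -(v / D) ^ 2 * ρ + 2 * (v / D) * ρr - ρrr;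
  let Y120 := (v / D) ^ 2 * ρ;
  let Y220 := (v / D) ^ 2 * ρ - 2 * (v / D) * ρr + 2 * ρrr;
  let Y111 := (0 : ℝ);
  let Y211 := -(2 * (v / D) * ρr) + 2 * ρrr;
  let Y102 := (v / D) ^ 2 * ρ - 2 * (v / D) * ρr + ρrr;
  let Y202 := (v / D) ^ 2 * ρ - 2 * (v / D) * ρr + ρrr;
  let X130 := (v / D) ^ 3 * ρ;
  let X230 := (v / D) ^ 3 * ρ - 2 * (v / D) ^ 2 * ρr + 2 * (v / D) * ρrr;
  let X121 := (0 : ℝ);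
  let X221 := -(2 * (v / D) * ρrr) + 2 * ρrrr;
  let X112 := (0 : ℝ);
  let X212 := 2 * (v / D) ^ 2 * ρr - 4 * (v / D) * ρrr + 2 * ρrrr;
  let X103 := -(v / D) ^ 3 * ρ + 2 * (v / D) ^ 2 * ρr - 2 * (v / D) * ρrr + 2 / 3 * ρrrr;
  let X203 := -(v / D) ^ 3 * ρ + 2 * (v / D) ^ 2 * ρr - 2 * (v / D) * ρrr + 2 / 3 * ρrrr;
  let Snu : ℕ → ℝ := fun a => if a = 0 then (1 : ℝ) else β;
  let Cd := deriv Chat ρ;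
  let Cdd := iteratedDeriv 2 Chat ρ;
  β * ((1 + ε) * (δ - 1) / 2 ^ (m + 1)) * (v ^ 2 * Chat ρ / D) *
      (∑ p ∈ Finset.range m',
        ((m.choose (2 * p + 1) : ℝ) * X10 ^ (2 * p + 1) * X01 ^ (2 * (m' - p) - 1)))
    - v / 2 ^ (m + 1) * Cd *
      ((∑ p ∈ Finset.range (m' + 1),
          ((m.choose (2 * p) : ℝ) * X10 ^ (2 * p) * X01 ^ (2 * (m' - p)) *
            ((δ + 1) * Y101 * Snu (2 * p) + (δ - 1) * Y110 * Snu (2 * (m' - p)) +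
              ε * ((δ + 1) * Y201 * Snu (2 * p) + (δ - 1) * Y210 * Snu (2 * (m' - p))))))
        + β * (∑ p ∈ Finset.range m',
          ((m.choose (2 * p + 1) : ℝ) * X10 ^ (2 * p + 1) * X01 ^ (2 * (m' - p) - 1) *
            ((δ - 1) * Y101 + (δ + 1) * Y110 +
              ε * ((δ - 1) * Y201 + (δ + 1) * Y210)))))
    - (m : ℝ) * v / 2 ^ (m + 1) * Chat ρ *
      ((∑ p ∈ Finset.range m',
          (((m - 1).choose (2 * p) : ℝ) * X10 ^ (2 * p) * X01 ^ (2 * (m' - p) - 1) *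
            ((δ + 1) * X102 * Snu (2 * p) + β * (δ - 1) * X111 + β * (δ + 1) * X120 +
              ε * ((δ + 1) * X202 * Snu (2 * p) + β * (δ - 1) * X211 +
                β * (δ + 1) * X220))))
        + (∑ p ∈ Finset.range m',
          (((m - 1).choose (2 * p + 1) : ℝ) * X10 ^ (2 * p + 1) * X01 ^ (2 * (m' - p - 1)) *
            (β * (δ - 1) * X102 + β * (δ + 1) * X111 +
                (δ - 1) * X120 * Snu (2 * (m' - p - 1)) +
              ε * (β * (δ - 1) * X202 + β * (δ + 1) * X211 +
                (δ - 1) * X220 * Snu (2 * (m' - p - 1)))))))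
    + (δ + 1) * (D / 2 ^ (m + 1)) *
      ((∑ p ∈ Finset.range (m' + 1),
          ((m.choose (2 * p) : ℝ) * X10 ^ (2 * p) * X01 ^ (2 * (m' - p)) *
            (Cd * (Y102 * Snu (2 * p) + Y120 * Snu (2 * (m' - p)) +
                ε * (Y202 * Snu (2 * p) + Y220 * Snu (2 * (m' - p)))) +
              1 / 2 * Cdd * (Y101 ^ 2 * Snu (2 * p) + Y110 ^ 2 * Snu (2 * (m' - p)) +
                ε * (Y201 ^ 2 * Snu (2 * p) + Y210 ^ 2 * Snu (2 * (m' - p)))))))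
        + β * (∑ p ∈ Finset.range m',
          ((m.choose (2 * p + 1) : ℝ) * X10 ^ (2 * p + 1) * X01 ^ (2 * (m' - p) - 1) *
            (Cd * (Y111 + ε * Y211) + Cdd * (Y101 * Y110 + ε * (Y201 * Y210))))))
    + (δ + 1) * ((m : ℝ) * D / 2 ^ (m + 1)) *
      ((∑ p ∈ Finset.range m',
          (((m - 1).choose (2 * p) : ℝ) * X10 ^ (2 * p) * X01 ^ (2 * (m' - p) - 1) *
            (Cd * (X102 * Y101 * Snu (2 * p) + β * X111 * Y110 + β * X120 * Y101 +
                ε * (X202 * Y201 * Snu (2 * p) + β * X211 * Y210 + β * X220 * Y201)) +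
              Chat ρ * (X103 * Snu (2 * p) + β * X121 +
                ε * (X203 * Snu (2 * p) + β * X221)))))
        + (∑ p ∈ Finset.range m',
          (((m - 1).choose (2 * p + 1) : ℝ) * X10 ^ (2 * p + 1) * X01 ^ (2 * (m' - p - 1)) *
            (Cd * (β * X102 * Y110 + β * X111 * Y101 +
                  X120 * Y110 * Snu (2 * (m' - p - 1)) +
                ε * (β * X202 * Y210 + β * X211 * Y201 +
                  X220 * Y210 * Snu (2 * (m' - p - 1)))) +
              Chat ρ * (β * X112 + X130 * Snu (2 * (m' - p - 1)) +
                ε * (β * X212 + X230 * Snu (2 * (m' - p - 1))))))))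
    + (δ + 1) * ((m : ℝ) * ((m : ℝ) - 1) / 2 ^ (m + 2)) * D * Chat ρ *
      ((∑ p ∈ Finset.range m',
          (((m - 2).choose (2 * p) : ℝ) * X10 ^ (2 * p) * X01 ^ (2 * (m' - p - 1)) *
            (X102 ^ 2 * Snu (2 * p) + 2 * β * X102 * X120 + β * X111 ^ 2 +
                X120 ^ 2 * Snu (2 * (m' - p - 1)) +
              ε * (X202 ^ 2 * Snu (2 * p) + 2 * β * X202 * X220 + β * X211 ^ 2 +
                X220 ^ 2 * Snu (2 * (m' - p - 1))))))
        + β * (∑ p ∈ Finset.range (m' - 1),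
          (((m - 2).choose (2 * p + 1) : ℝ) * X10 ^ (2 * p + 1) *
              X01 ^ (2 * (m' - p - 1) - 1) *
            (2 * X102 * X111 + 2 * X111 * X120 +
              ε * (2 * X202 * X211 + 2 * X211 * X220)))))

/-! ### Taylor expansion with a controlled intermediate point -/

/-- Lagrange form of Taylor's theorem for a smooth function, for increments of either sign. -/
lemma exists_taylor_lagrange {g : ℝ → ℝ} (hg : ContDiff ℝ (⊤ : ℕ∞) g) (n : ℕ) (x d : ℝ) :
    ∃ ζ, |ζ - x| ≤ |d| ∧
      g (x + d) = ∑ i ∈ range (n + 1), iteratedDeriv i g x / (i.factorial : ℝ) * d ^ i +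
        iteratedDeriv (n + 1) g ζ / ((n + 1).factorial : ℝ) * d ^ (n + 1) := by
  rcases eq_or_ne d 0 with rfl | hd
  · refine ⟨x, by simp, ?_⟩
    simp [Finset.sum_range_succ']
  · have hx : x ≠ x + d := by simpa using hd
    obtain ⟨ζ, hζ, h⟩ := taylor_mean_remainder_lagrange_iteratedDeriv (n := n) hx
      ((hg.of_le (by exact_mod_cast le_top)).contDiffOn)
    refine ⟨ζ, ?_, ?_⟩
    · have := Set.uIoo_subset_uIcc_self hζ
      have h2 := Set.abs_sub_left_of_mem_uIcc this
      simpa using h2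
    · rw [sub_eq_iff_eq_add'] at h
      rw [h, taylor_within_apply]
      congr 1
      · refine Finset.sum_congr rfl fun i _ => ?_
        rw [iteratedDerivWithin_eq_iteratedDeriv (uniqueDiffOn_uIcc hx)
          ((hg.of_le (by exact_mod_cast le_top)).contDiffAt) Set.left_mem_uIcc]
        simp only [add_sub_cancel_left, smul_eq_mul]
        ring
      · rw [add_sub_cancel_left]
        ring

/-- Partial derivatives in the first variable of a smooth function of two variables are jointly
smooth. -/
lemma contDiff_iteratedDeriv_fst {F : ℝ × ℝ → ℝ} (hF : ContDiff ℝ (⊤ : ℕ∞) F) (n : ℕ) :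
    ContDiff ℝ (⊤ : ℕ∞) fun z : ℝ × ℝ => iteratedDeriv n (fun X => F (X, z.2)) z.1 := by
  induction n with
  | zero => simpa using hF
  | succ n ih =>
    set G : ℝ × ℝ → ℝ := fun z => iteratedDeriv n (fun X => F (X, z.2)) z.1 with hG
    have key : (fun z : ℝ × ℝ => iteratedDeriv (n + 1) (fun X => F (X, z.2)) z.1) =
        fun z => fderiv ℝ G z (1, 0) := by
      funext z
      rw [iteratedDeriv_succ]
      have h1 : HasFDerivAt G (fderiv ℝ G z) (z.1, z.2) :=
        (ih.differentiable (by simp) z).hasFDerivAt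
      have h2 : HasDerivAt (fun X : ℝ => (X, z.2)) ((1 : ℝ), (0 : ℝ)) z.1 :=
        (hasDerivAt_id z.1).prodMk (hasDerivAt_const z.1 z.2)
      exact (h1.comp_hasDerivAt z.1 h2).deriv
    rw [key]
    exact (ih.fderiv_right (m := (⊤ : ℕ∞)) (by simp)).clm_apply contDiff_const

/-- A point trapped between `p h` and `p h + d h` follows the limit of `p` when `d` vanishes. -/
lemma tendsto_of_abs_sub_le {l : Filter ℝ} {ζ p d : ℝ → ℝ} {P : ℝ}
    (h : ∀ x, |ζ x - p x| ≤ |d x|) (hp : Tendsto p l (nhds P)) (hd : Tendsto d l (nhds 0)) :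
    Tendsto ζ l (nhds P) := by
  have h0 : Tendsto (fun x => ζ x - p x) l (nhds 0) :=
    squeeze_zero_norm (fun x => by simpa using h x) (by simpa using hd.abs)
  simpa using h0.add hp

/-! ### Second-order expansions with moving coefficients -/

/-- `φ h = a h + b h * h + c h * h ^ 2` for small `h > 0`, where `a`, `b`, `c` converge to
`A`, `B`, `C` as `h → 0⁺`. -/
structure QuadExp (φ a b : ℝ → ℝ) (A B C : ℝ) : Prop where
  tendsto_zeroth : Tendsto a (nhdsWithin 0 (Set.Ioi 0)) (nhds A)
  tendsto_first : Tendsto b (nhdsWithin 0 (Set.Ioi 0)) (nhds B)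
  exists_second : ∃ c : ℝ → ℝ, Tendsto c (nhdsWithin 0 (Set.Ioi 0)) (nhds C) ∧
    ∀ᶠ h in nhdsWithin (0 : ℝ) (Set.Ioi 0), φ h = a h + b h * h + c h * h ^ 2

namespace QuadExp

variable {φ ψ a b a' b' : ℝ → ℝ} {A B C A' B' C' : ℝ}

lemma tendsto_id_zero : Tendsto (fun h : ℝ => h) (nhdsWithin 0 (Set.Ioi 0)) (nhds 0) :=
  tendsto_nhdsWithin_of_tendsto_nhds tendsto_id

lemma tendsto (h : QuadExp φ a b A B C) : Tendsto φ (nhdsWithin 0 (Set.Ioi 0)) (nhds A) := by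
  obtain ⟨ta, tb, c, tc, hc⟩ := h
  refine Tendsto.congr' (hc.mono fun x hx => hx.symm) ?_
  have := (ta.add (tb.mul tendsto_id_zero)).add (tc.mul (tendsto_id_zero.pow 2))
  simpa using this

lemma of_eq (h : QuadExp φ a b A B C) (hφ : ∀ᶠ x in nhdsWithin (0 : ℝ) (Set.Ioi 0), ψ x = φ x)
    (ha : ∀ x, a' x = a x) (hb : ∀ x, b' x = b x) (hA : A' = A) (hB : B' = B) (hC : C' = C) :
    QuadExp ψ a' b' A' B' C' := by
  obtain rfl : a' = a := funext ha
  obtain rfl : b' = b := funext hb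
  subst hA hB hC
  obtain ⟨ta, tb, c, tc, hc⟩ := h
  refine ⟨ta, tb, c, tc, ?_⟩
  filter_upwards [hφ, hc] with x h1 h2
  rw [h1, h2]

lemma add (h : QuadExp φ a b A B C) (h' : QuadExp ψ a' b' A' B' C') :
    QuadExp (fun x => φ x + ψ x) (fun x => a x + a' x) (fun x => b x + b' x)
      (A + A') (B + B') (C + C') := by
  obtain ⟨ta, tb, c, tc, hc⟩ := h
  obtain ⟨ta', tb', c', tc', hc'⟩ := h'
  refine ⟨ta.add ta', tb.add tb', fun x => c x + c' x, tc.add tc', ?_⟩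
  filter_upwards [hc, hc'] with x h1 h2
  rw [h1, h2]
  ring

lemma mul (h : QuadExp φ a b A B C) (h' : QuadExp ψ a' b' A' B' C') :
    QuadExp (fun x => φ x * ψ x) (fun x => a x * a' x) (fun x => a x * b' x + b x * a' x)
      (A * A') (A * B' + B * A') (A * C' + B * B' + C * A') := by
  obtain ⟨ta, tb, c, tc, hc⟩ := h
  obtain ⟨ta', tb', c', tc', hc'⟩ := h'
  refine ⟨ta.mul ta', (ta.mul tb').add (tb.mul ta'),
    fun x => a x * c' x + b x * b' x + c x * a' x + (b x * c' x + c x * b' x) * x +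
      c x * c' x * x ^ 2, ?_, ?_⟩
  · have := ((((ta.mul tc').add (tb.mul tb')).add (tc.mul ta')).add
      (((tb.mul tc').add (tc.mul tb')).mul tendsto_id_zero)).add
      ((tc.mul tc').mul (tendsto_id_zero.pow 2))
    simpa using this
  · filter_upwards [hc, hc'] with x h1 h2
    rw [h1, h2]
    ring

lemma const (k : ℝ) : QuadExp (fun _ => k) (fun _ => k) (fun _ => 0) k 0 0 :=
  ⟨tendsto_const_nhds, tendsto_const_nhds, fun _ => 0, tendsto_const_nhds, by simp⟩

lemma of_tendsto (h : Tendsto φ (nhdsWithin 0 (Set.Ioi 0)) (nhds A)) :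
    QuadExp φ φ (fun _ => 0) A 0 0 :=
  ⟨h, tendsto_const_nhds, fun _ => 0, tendsto_const_nhds, by simp⟩

lemma const_mul (k : ℝ) (h : QuadExp φ a b A B C) :
    QuadExp (fun x => k * φ x) (fun x => k * a x) (fun x => k * b x)
      (k * A) (k * B) (k * C) :=
  ((const k).mul h).of_eq (Eventually.of_forall fun _ => rfl) (fun _ => rfl)
    (fun _ => by ring) rfl (by ring) (by ring)

/-- Multiplication by the variable shifts the coefficients. -/
lemma id_mul (h : QuadExp φ a b A B C) :
    QuadExp (fun x => x * φ x) (fun _ => 0) a 0 A B := by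
  obtain ⟨ta, tb, c, tc, hc⟩ := h
  refine ⟨tendsto_const_nhds, ta, fun x => b x + c x * x, ?_, ?_⟩
  · simpa using tb.add (tc.mul tendsto_id_zero)
  · filter_upwards [hc] with x h1
    rw [h1]
    ring

lemma sum {ι : Type*} (s : Finset ι) {φ a b : ι → ℝ → ℝ} {A B C : ι → ℝ}
    (h : ∀ i ∈ s, QuadExp (φ i) (a i) (b i) (A i) (B i) (C i)) :
    QuadExp (fun x => ∑ i ∈ s, φ i x) (fun x => ∑ i ∈ s, a i x) (fun x => ∑ i ∈ s, b i x)
      (∑ i ∈ s, A i) (∑ i ∈ s, B i) (∑ i ∈ s, C i) := by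
  classical
  induction s using Finset.induction_on with
  | empty => simpa using const 0
  | insert i s hi ih =>
    simp only [Finset.sum_insert hi]
    exact (h i (Finset.mem_insert_self i s)).add
      (ih fun j hj => h j (Finset.mem_insert_of_mem hj))

/-- Composition with a smooth function. -/
lemma comp {g : ℝ → ℝ} (hg : ContDiff ℝ (⊤ : ℕ∞) g) (h : QuadExp φ a b A B C) :
    QuadExp (fun x => g (φ x)) (fun x => g (a x)) (fun x => deriv g (a x) * b x)
      (g A) (deriv g A * B) (deriv g A * C + iteratedDeriv 2 g A / 2 * B ^ 2) := by
  obtain ⟨ta, tb, c, tc, hc⟩ := h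
  have hg1 : Continuous (deriv g) := by
    simpa using hg.continuous_iteratedDeriv 1 (by exact_mod_cast le_top)
  have hg2 : Continuous (iteratedDeriv 2 g) :=
    hg.continuous_iteratedDeriv 2 (WithTop.coe_le_coe.2 le_top)
  have T := fun x => exists_taylor_lagrange hg 1 (a x) (b x * x + c x * x ^ 2)
  choose ζ hζ hT using T
  have td : Tendsto (fun x => b x * x + c x * x ^ 2) (nhdsWithin 0 (Set.Ioi 0)) (nhds 0) := by
    simpa using (tb.mul tendsto_id_zero).add (tc.mul (tendsto_id_zero.pow 2))
  have tζ := tendsto_of_abs_sub_le hζ ta td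
  refine ⟨(hg.continuous.tendsto A).comp ta, ((hg1.tendsto A).comp ta).mul tb,
    fun x => deriv g (a x) * c x + iteratedDeriv 2 g (ζ x) / 2 * (b x + c x * x) ^ 2, ?_, ?_⟩
  · have h1 := ((hg1.tendsto A).comp ta).mul tc
    have h2 := (((hg2.tendsto A).comp tζ).div_const 2).mul
      ((tb.add (tc.mul tendsto_id_zero)).pow 2)
    simpa using h1.add h2
  · filter_upwards [hc] with x h1
    rw [h1, add_assoc, hT x]
    simp [Finset.sum_range_succ, iteratedDeriv_one]
    ring

lemma pow (m : ℕ) (h : QuadExp φ a b A B C) :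
    QuadExp (fun x => φ x ^ m) (fun x => a x ^ m) (fun x => m * a x ^ (m - 1) * b x)
      (A ^ m) (m * A ^ (m - 1) * B)
      (m * A ^ (m - 1) * C + m * ((m : ℝ) - 1) * A ^ (m - 2) / 2 * B ^ 2) := by
  have h2 : iteratedDeriv 2 (fun y : ℝ => y ^ m) A = m * ((m : ℝ) - 1) * A ^ (m - 2) := by
    rcases m with _ | m
    · simp [iteratedDeriv_succ]
    · simp [mul_assoc]
      ring
  refine (h.comp (g := fun y => y ^ m) (contDiff_id.pow m)).of_eq
    (Eventually.of_forall fun _ => rfl) (fun _ => rfl) (fun x => by simp) rfl (by simp) ?_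
  rw [h2]
  simp

/-- If the two leading coefficients vanish identically, `φ h / h ^ 2` has a limit. -/
lemma tendsto_div_sq (h : QuadExp φ a b A B C) (ha : ∀ x, a x = 0) (hb : ∀ x, b x = 0) :
    Tendsto (fun x => φ x / x ^ 2) (nhdsWithin 0 (Set.Ioi 0)) (nhds C) := by
  obtain ⟨-, -, c, tc, hc⟩ := h
  refine tc.congr' ?_
  filter_upwards [hc, self_mem_nhdsWithin] with x h1 (h2 : 0 < x)
  rw [h1, ha, hb]
  field_simp
  ring

end QuadExp

/-! ### The characteristic function -/

lemma contDiff_ftilde {f : ℝ → ℝ → ℝ} (hf : ContDiff ℝ (⊤ : ℕ∞) (Function.uncurry f)) :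
    ContDiff ℝ (⊤ : ℕ∞) fun z : ℝ × ℝ => ftilde f z.1 z.2 :=
  hf.comp ((contDiff_snd.add contDiff_fst).prodMk (contDiff_snd.sub contDiff_fst))

lemma contDiff_characteristic {f : ℝ → ℝ → ℝ} (hf : ContDiff ℝ (⊤ : ℕ∞) (Function.uncurry f))
    {m : ℕ} {Chat : ℝ → ℝ}
    (hchar : ∀ Y : ℝ, iteratedDeriv m (fun X => ftilde f X Y) 0 = (m.factorial : ℝ) * Chat Y) :
    ContDiff ℝ (⊤ : ℕ∞) Chat := by
  have h : Chat = fun Y => iteratedDeriv m (fun X => ftilde f X Y) 0 / (m.factorial : ℝ) := by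
    funext Y
    rw [hchar]
    field_simp
  rw [h]
  exact ((contDiff_iteratedDeriv_fst (contDiff_ftilde hf) m).comp
    (contDiff_const.prodMk contDiff_id)).div_const _

/-- For even `m` the correction to `f̃(X, Y) ≈ Ĉ(Y) X ^ m` is of relative order `X ^ 2`. -/
lemma exists_ftilde_eq {f : ℝ → ℝ → ℝ} (hf : ContDiff ℝ (⊤ : ℕ∞) (Function.uncurry f))
    {m : ℕ} {Chat : ℝ → ℝ} (hm : Even m) (hsym : ∀ x y, f y x = (-1 : ℝ) ^ m * f x y)
    (hlow : ∀ Y : ℝ, ∀ j < m, iteratedDeriv j (fun X => ftilde f X Y) 0 = 0)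
    (hchar : ∀ Y : ℝ, iteratedDeriv m (fun X => ftilde f X Y) 0 = (m.factorial : ℝ) * Chat Y)
    (X Y : ℝ) :
    ∃ ζ, |ζ - 0| ≤ |X| ∧ ftilde f X Y = X ^ m * Chat Y +
      iteratedDeriv (m + 2) (fun X => ftilde f X Y) ζ / ((m + 2).factorial : ℝ) * X ^ (m + 2) := by
  have hsm : ContDiff ℝ (⊤ : ℕ∞) fun X => ftilde f X Y :=
    (contDiff_ftilde hf).comp (contDiff_id.prodMk contDiff_const)
  obtain ⟨ζ, hζ, hT⟩ := exists_taylor_lagrange hsm (m + 1) 0 X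
  refine ⟨ζ, hζ, ?_⟩
  have hodd : iteratedDeriv (m + 1) (fun X => ftilde f X Y) 0 = 0 := by
    have heven : (fun X => ftilde f (-X) Y) = fun X => ftilde f X Y := by
      funext X
      simpa [ftilde, hm.neg_one_pow, sub_eq_add_neg] using hsym (Y + X) (Y - X)
    have h := iteratedDeriv_comp_neg (m + 1) (fun X => ftilde f X Y) 0
    rw [heven, hm.add_one.neg_one_pow] at h
    simp only [neg_zero, neg_smul, one_smul] at h
    linarith
  rw [zero_add] at hT
  rw [hT, Finset.sum_range_succ, Finset.sum_range_succ, hodd, hchar,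
    Finset.sum_eq_zero fun i hi => by rw [hlow Y i (Finset.mem_range.1 hi)]; simp]
  field_simp
  ring

/-- Expansion of `h ^ (-m) * f̃(h x, p + h y)`. -/
lemma QuadExp.ftilde_div_pow {f : ℝ → ℝ → ℝ}
    (hf : ContDiff ℝ (⊤ : ℕ∞) (Function.uncurry f))
    {m : ℕ} {Chat : ℝ → ℝ} (hm : Even m) (hsym : ∀ x y, f y x = (-1 : ℝ) ^ m * f x y)
    (hlow : ∀ Y : ℝ, ∀ j < m, iteratedDeriv j (fun X => ftilde f X Y) 0 = 0)
    (hchar : ∀ Y : ℝ, iteratedDeriv m (fun X => ftilde f X Y) 0 = (m.factorial : ℝ) * Chat Y)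
    {p x y x₁ x₂ y₁ y₂ : ℝ → ℝ} {P X₁ X₂ X₃ Y₁ Y₂ Y₃ : ℝ}
    (hp : Tendsto p (nhdsWithin 0 (Set.Ioi 0)) (nhds P))
    (hx : QuadExp x x₁ x₂ X₁ X₂ X₃) (hy : QuadExp y y₁ y₂ Y₁ Y₂ Y₃) :
    QuadExp (fun h => (h ^ m)⁻¹ * ftilde f (h * x h) (p h + h * y h))
      (fun h => x₁ h ^ m * Chat (p h))
      (fun h => x₁ h ^ m * (deriv Chat (p h) * y₁ h) +
        m * x₁ h ^ (m - 1) * x₂ h * Chat (p h))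
      (X₁ ^ m * Chat P)
      (X₁ ^ m * (deriv Chat P * Y₁) + m * X₁ ^ (m - 1) * X₂ * Chat P)
      (X₁ ^ m * (deriv Chat P * Y₂ + iteratedDeriv 2 Chat P / 2 * Y₁ ^ 2) +
        m * X₁ ^ (m - 1) * X₂ * (deriv Chat P * Y₁) +
        (m * X₁ ^ (m - 1) * X₃ + m * ((m : ℝ) - 1) * X₁ ^ (m - 2) / 2 * X₂ ^ 2) * Chat P +
        iteratedDeriv (m + 2) (fun X => ftilde f X P) 0 / ((m + 2).factorial : ℝ) *
          X₁ ^ (m + 2)) := by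
  have hC := contDiff_characteristic hf hchar
  have hY := (QuadExp.of_tendsto hp).add hy.id_mul
  have main := (hx.pow m).mul (hY.comp hC)
  choose ζ hζ hT using fun h =>
    exists_ftilde_eq hf hm hsym hlow hchar (h * x h) (p h + h * y h)
  have tζ : Tendsto ζ (nhdsWithin 0 (Set.Ioi 0)) (nhds 0) :=
    tendsto_of_abs_sub_le hζ tendsto_const_nhds (by simpa using hx.id_mul.tendsto)
  have tY : Tendsto (fun h => p h + h * y h) (nhdsWithin 0 (Set.Ioi 0)) (nhds P) := by
    simpa using hY.tendsto
  have tR := ((((contDiff_iteratedDeriv_fst (contDiff_ftilde hf) (m + 2)).continuous.tendsto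
    (0, P)).comp (tζ.prodMk_nhds tY)).div_const ((m + 2).factorial : ℝ)).mul
    (hx.tendsto.pow (m + 2))
  have rem := (QuadExp.of_tendsto tR).id_mul.id_mul
  refine (main.add rem).of_eq ?_ (fun h => by simp) (fun h => by simp) (by simp) (by simp) ?_
  · filter_upwards [self_mem_nhdsWithin] with h (hh : 0 < h)
    rw [hT h]
    simp only [Function.comp]
    field_simp
    ring
  · simp only [add_zero, zero_add]

/-! ### Even and odd parts of binomial sums -/

/-- The part of `(A + B) ^ n` that is even in `B`. -/
def binomEven (A B : ℝ) (n : ℕ) : ℝ := ((A + B) ^ n + (A - B) ^ n) / 2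

/-- The part of `(A + B) ^ n` that is odd in `B`. -/
def binomOdd (A B : ℝ) (n : ℕ) : ℝ := ((A + B) ^ n - (A - B) ^ n) / 2

lemma sum_range_two_mul_eq (g : ℕ → ℝ) (N : ℕ) :
    ∑ i ∈ range (2 * N), g i = ∑ p ∈ range N, g (2 * p) + ∑ p ∈ range N, g (2 * p + 1) := by
  induction N with
  | zero => simp
  | succ N ih =>
    rw [show 2 * (N + 1) = 2 * N + 1 + 1 by ring, Finset.sum_range_succ, Finset.sum_range_succ, ih,
      Finset.sum_range_succ, Finset.sum_range_succ]
    ring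

lemma add_pow_two_mul (A B : ℝ) (N : ℕ) :
    (A + B) ^ (2 * N) =
      ∑ p ∈ range (N + 1), ((2 * N).choose (2 * p) : ℝ) * A ^ (2 * p) * B ^ (2 * (N - p)) +
      ∑ p ∈ range N,
        ((2 * N).choose (2 * p + 1) : ℝ) * A ^ (2 * p + 1) * B ^ (2 * (N - p) - 1) := by
  rw [add_pow, Finset.sum_range_succ, sum_range_two_mul_eq, Finset.sum_range_succ _ N,
    add_right_comm]
  congr 1
  · congr 1
    · refine Finset.sum_congr rfl fun p _ => ?_
      rw [Nat.mul_sub]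
      ring
    · simp
  · refine Finset.sum_congr rfl fun p _ => ?_
    rw [show 2 * N - (2 * p + 1) = 2 * (N - p) - 1 by omega]
    ring

lemma add_pow_two_mul_succ_sub_one (A B : ℝ) (N : ℕ) :
    (A + B) ^ (2 * (N + 1) - 1) =
      ∑ p ∈ range (N + 1),
        ((2 * (N + 1) - 1).choose (2 * p) : ℝ) * A ^ (2 * p) * B ^ (2 * (N + 1 - p) - 1) +
      ∑ p ∈ range (N + 1),
        ((2 * (N + 1) - 1).choose (2 * p + 1) : ℝ) * A ^ (2 * p + 1) *
          B ^ (2 * (N + 1 - p - 1)) := by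
  rw [add_pow, show 2 * (N + 1) - 1 + 1 = 2 * (N + 1) by omega, sum_range_two_mul_eq]
  congr 1
  · refine Finset.sum_congr rfl fun p _ => ?_
    rw [show 2 * (N + 1) - 1 - 2 * p = 2 * (N + 1 - p) - 1 by omega]
    ring
  · refine Finset.sum_congr rfl fun p _ => ?_
    rw [show 2 * (N + 1) - 1 - (2 * p + 1) = 2 * (N + 1 - p - 1) by omega]
    ring

lemma neg_pow_two_mul_sub_one (B : ℝ) {j : ℕ} (hj : 0 < j) :
    (-B) ^ (2 * j - 1) = -B ^ (2 * j - 1) :=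
  Odd.neg_pow ⟨j - 1, by omega⟩ B

lemma sub_pow_two_mul (A B : ℝ) (N : ℕ) :
    (A - B) ^ (2 * N) =
      ∑ p ∈ range (N + 1), ((2 * N).choose (2 * p) : ℝ) * A ^ (2 * p) * B ^ (2 * (N - p)) -
      ∑ p ∈ range N,
        ((2 * N).choose (2 * p + 1) : ℝ) * A ^ (2 * p + 1) * B ^ (2 * (N - p) - 1) := by
  rw [sub_eq_add_neg A B, add_pow_two_mul, sub_eq_add_neg, ← Finset.sum_neg_distrib]
  congr 1
  · exact Finset.sum_congr rfl fun p _ => by rw [(even_two_mul (N - p)).neg_pow]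
  · refine Finset.sum_congr rfl fun p hp => ?_
    rw [neg_pow_two_mul_sub_one B (Nat.sub_pos_of_lt (Finset.mem_range.1 hp))]
    ring

lemma sub_pow_two_mul_succ_sub_one (A B : ℝ) (N : ℕ) :
    (A - B) ^ (2 * (N + 1) - 1) =
      -∑ p ∈ range (N + 1),
        ((2 * (N + 1) - 1).choose (2 * p) : ℝ) * A ^ (2 * p) * B ^ (2 * (N + 1 - p) - 1) +
      ∑ p ∈ range (N + 1),
        ((2 * (N + 1) - 1).choose (2 * p + 1) : ℝ) * A ^ (2 * p + 1) *
          B ^ (2 * (N + 1 - p - 1)) := by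
  rw [sub_eq_add_neg A B, add_pow_two_mul_succ_sub_one, ← Finset.sum_neg_distrib]
  congr 1
  · refine Finset.sum_congr rfl fun p hp => ?_
    rw [neg_pow_two_mul_sub_one B (Nat.sub_pos_of_lt (Finset.mem_range.1 hp))]
    ring
  · exact Finset.sum_congr rfl fun p _ => by rw [(even_two_mul (N + 1 - p - 1)).neg_pow]

/-- A sum weighted by an affine function of the boundary indicators of the two end points. -/
lemma sum_mul_boundary (c : ℕ → ℝ) (β x y z : ℝ) (N : ℕ) :
    ∑ p ∈ range (N + 1), c p * (x * (if 2 * p = 0 then (1 : ℝ) else β) +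
        y * (if 2 * (N - p) = 0 then (1 : ℝ) else β) + z) =
      ((x + y) * β + z) * ∑ p ∈ range (N + 1), c p + (1 - β) * (x * c 0 + y * c N) := by
  have h1 : ∑ p ∈ range (N + 1), (if p = 0 then c p else 0) = c 0 := by simp
  have h2 : ∑ p ∈ range (N + 1), (if p = N then c p else 0) = c N := by simp
  rw [← h1, ← h2, Finset.mul_sum, Finset.mul_sum, Finset.mul_sum, ← Finset.sum_add_distrib,
    Finset.mul_sum, ← Finset.sum_add_distrib]
  refine Finset.sum_congr rfl fun p hp => ?_
  have hp' := Finset.mem_range.1 hp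
  have e1 : (2 * p = 0) = (p = 0) := by simp
  have e2 : (2 * (N - p) = 0) = (p = N) := propext (by omega)
  simp only [e1, e2]
  split_ifs <;> ring

lemma sum_choose_even_boundary (A B β x y z : ℝ) (N : ℕ) :
    ∑ p ∈ range (N + 1), ((2 * N).choose (2 * p) : ℝ) * A ^ (2 * p) * B ^ (2 * (N - p)) *
        (x * (if 2 * p = 0 then (1 : ℝ) else β) +
          y * (if 2 * (N - p) = 0 then (1 : ℝ) else β) + z) =
      ((x + y) * β + z) * binomEven A B (2 * N) +
        (1 - β) * (x * B ^ (2 * N) + y * A ^ (2 * N)) := by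
  rw [sum_mul_boundary
    (fun p => ((2 * N).choose (2 * p) : ℝ) * A ^ (2 * p) * B ^ (2 * (N - p))),
    binomEven, add_pow_two_mul, sub_pow_two_mul]
  simp

lemma sum_choose_odd (A B z : ℝ) (N : ℕ) :
    ∑ p ∈ range N, ((2 * N).choose (2 * p + 1) : ℝ) * A ^ (2 * p + 1) *
        B ^ (2 * (N - p) - 1) * z = z * binomOdd A B (2 * N) := by
  rw [← Finset.sum_mul, binomOdd, add_pow_two_mul, sub_pow_two_mul]
  ring

lemma sum_pred_choose_even_boundary (A B β x z : ℝ) (N : ℕ) :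
    ∑ p ∈ range (N + 1), ((2 * (N + 1) - 1).choose (2 * p) : ℝ) * A ^ (2 * p) *
        B ^ (2 * (N + 1 - p) - 1) * (x * (if 2 * p = 0 then (1 : ℝ) else β) + z) =
      (x * β + z) * binomOdd A B (2 * (N + 1) - 1) + (1 - β) * (x * B ^ (2 * (N + 1) - 1)) := by
  have h := sum_mul_boundary (fun p => ((2 * (N + 1) - 1).choose (2 * p) : ℝ) * A ^ (2 * p) *
    B ^ (2 * (N + 1 - p) - 1)) β x 0 z N
  simp only [zero_mul, add_zero] at h
  rw [h, binomOdd, add_pow_two_mul_succ_sub_one, sub_pow_two_mul_succ_sub_one]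
  simp

lemma sum_pred_choose_odd_boundary (A B β y z : ℝ) (N : ℕ) :
    ∑ p ∈ range (N + 1), ((2 * (N + 1) - 1).choose (2 * p + 1) : ℝ) * A ^ (2 * p + 1) *
        B ^ (2 * (N + 1 - p - 1)) *
          (y * (if 2 * (N + 1 - p - 1) = 0 then (1 : ℝ) else β) + z) =
      (y * β + z) * binomEven A B (2 * (N + 1) - 1) +
        (1 - β) * (y * A ^ (2 * (N + 1) - 1)) := by
  have e : ∀ p, N + 1 - p - 1 = N - p := fun p => by omega
  have h := sum_mul_boundary (fun p => ((2 * (N + 1) - 1).choose (2 * p + 1) : ℝ) *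
    A ^ (2 * p + 1) * B ^ (2 * (N + 1 - p - 1))) β 0 y z N
  simp only [zero_mul, zero_add, e] at h
  rw [binomEven, add_pow_two_mul_succ_sub_one, sub_pow_two_mul_succ_sub_one]
  simp only [e]
  rw [h]
  simp only [show 2 * (N + 1) - 1 = 2 * N + 1 by omega, Nat.sub_self, mul_zero, pow_zero,
    Nat.choose_self, Nat.cast_one, mul_one, one_mul]
  ring

lemma sum_pred_pred_choose_even_boundary (A B β x y z : ℝ) (N : ℕ) :
    ∑ p ∈ range (N + 1), ((2 * (N + 1) - 2).choose (2 * p) : ℝ) * A ^ (2 * p) *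
        B ^ (2 * (N + 1 - p - 1)) * (x * (if 2 * p = 0 then (1 : ℝ) else β) +
          y * (if 2 * (N + 1 - p - 1) = 0 then (1 : ℝ) else β) + z) =
      ((x + y) * β + z) * binomEven A B (2 * (N + 1) - 2) +
        (1 - β) * (x * B ^ (2 * (N + 1) - 2) + y * A ^ (2 * (N + 1) - 2)) := by
  have e : ∀ p, N + 1 - p - 1 = N - p := fun p => by omega
  simp only [e, show 2 * (N + 1) - 2 = 2 * N by omega]
  exact sum_choose_even_boundary A B β x y z N

lemma sum_pred_pred_choose_odd (A B z : ℝ) (N : ℕ) :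
    ∑ p ∈ range (N + 1 - 1), ((2 * (N + 1) - 2).choose (2 * p + 1) : ℝ) * A ^ (2 * p + 1) *
        B ^ (2 * (N + 1 - p - 1) - 1) * z = z * binomOdd A B (2 * (N + 1) - 2) := by
  have e : ∀ p, N + 1 - p - 1 = N - p := fun p => by omega
  simp only [e, show 2 * (N + 1) - 2 = 2 * N by omega, Nat.add_sub_cancel]
  exact sum_choose_odd A B z N

/-! ### The limit value in closed form -/

/-- The contribution of one of the two local terms to the limit value, with the binomial sums
evaluated. `A`, `B` stand for `X₁₀`, `X₀₁`. -/
def closedCoeff (D v β δ C₀ C₁ C₂ A B Y10 Y01 X20 X11 X02 Y20 Y11 Y02 X30 X21 X12 X03 : ℝ)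
    (m : ℕ) : ℝ :=
  β * ((δ - 1) / 2 ^ (m + 1)) * (v ^ 2 * C₀ / D) * binomOdd A B m
    - v / 2 ^ (m + 1) * C₁ *
      ((((δ + 1) * Y01 + (δ - 1) * Y10) * β * binomEven A B m +
          (1 - β) * ((δ + 1) * Y01 * B ^ m + (δ - 1) * Y10 * A ^ m)) +
        β * (((δ - 1) * Y01 + (δ + 1) * Y10) * binomOdd A B m))
    - (m : ℝ) * v / 2 ^ (m + 1) * C₀ *
      ((((δ + 1) * X02 * β + (β * (δ - 1) * X11 + β * (δ + 1) * X20)) * binomOdd A B (m - 1) +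
          (1 - β) * ((δ + 1) * X02 * B ^ (m - 1))) +
        (((δ - 1) * X20 * β + (β * (δ - 1) * X02 + β * (δ + 1) * X11)) * binomEven A B (m - 1) +
          (1 - β) * ((δ - 1) * X20 * A ^ (m - 1))))
    + (δ + 1) * (D / 2 ^ (m + 1)) *
      (((C₁ * (Y02 + Y20) + 1 / 2 * C₂ * (Y01 ^ 2 + Y10 ^ 2)) * β * binomEven A B m +
          (1 - β) * ((C₁ * Y02 + 1 / 2 * C₂ * Y01 ^ 2) * B ^ m +
            (C₁ * Y20 + 1 / 2 * C₂ * Y10 ^ 2) * A ^ m)) +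
        β * ((C₁ * Y11 + C₂ * (Y01 * Y10)) * binomOdd A B m))
    + (δ + 1) * ((m : ℝ) * D / 2 ^ (m + 1)) *
      ((((C₁ * (X02 * Y01) + C₀ * X03) * β +
            (C₁ * (β * X11 * Y10 + β * X20 * Y01) + C₀ * (β * X21))) * binomOdd A B (m - 1) +
          (1 - β) * ((C₁ * (X02 * Y01) + C₀ * X03) * B ^ (m - 1))) +
        (((C₁ * (X20 * Y10) + C₀ * X30) * β +
            (C₁ * (β * X02 * Y10 + β * X11 * Y01) + C₀ * (β * X12))) * binomEven A B (m - 1) +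
          (1 - β) * ((C₁ * (X20 * Y10) + C₀ * X30) * A ^ (m - 1))))
    + (δ + 1) * ((m : ℝ) * ((m : ℝ) - 1) / 2 ^ (m + 2)) * D * C₀ *
      ((((X02 ^ 2 + X20 ^ 2) * β + (2 * β * X02 * X20 + β * X11 ^ 2)) * binomEven A B (m - 2) +
          (1 - β) * (X02 ^ 2 * B ^ (m - 2) + X20 ^ 2 * A ^ (m - 2))) +
        β * ((2 * X02 * X11 + 2 * X11 * X20) * binomOdd A B (m - 2)))

/-- `LI2` as the sum of the two closed-form contributions. -/
lemma LI2_eq_closedCoeff (D v β r : ℝ) (ρ₀ Chat : ℝ → ℝ) (ε δ : ℝ) (m' : ℕ) :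
    LI2 D v β r ρ₀ Chat ε δ (2 * m') m' =
      closedCoeff D v β δ (Chat (ρ₀ r)) (deriv Chat (ρ₀ r)) (iteratedDeriv 2 Chat (ρ₀ r))
        (v / D * ρ₀ r) (-(v / D) * ρ₀ r + deriv ρ₀ r)
        (v / D * ρ₀ r) (v / D * ρ₀ r - deriv ρ₀ r)
        ((v / D) ^ 2 * ρ₀ r) 0
        (-(v / D) ^ 2 * ρ₀ r + 2 * (v / D) * deriv ρ₀ r - iteratedDeriv 2 ρ₀ r)
        ((v / D) ^ 2 * ρ₀ r) 0
        ((v / D) ^ 2 * ρ₀ r - 2 * (v / D) * deriv ρ₀ r + iteratedDeriv 2 ρ₀ r)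
        ((v / D) ^ 3 * ρ₀ r) 0 0
        (-(v / D) ^ 3 * ρ₀ r + 2 * (v / D) ^ 2 * deriv ρ₀ r -
          2 * (v / D) * iteratedDeriv 2 ρ₀ r + 2 / 3 * iteratedDeriv 3 ρ₀ r) (2 * m') +
      ε * closedCoeff D v β δ (Chat (ρ₀ r)) (deriv Chat (ρ₀ r)) (iteratedDeriv 2 Chat (ρ₀ r))
        (v / D * ρ₀ r) (-(v / D) * ρ₀ r + deriv ρ₀ r)
        (v / D * ρ₀ r - 2 * deriv ρ₀ r) (v / D * ρ₀ r - deriv ρ₀ r)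
        ((v / D) ^ 2 * ρ₀ r - 2 * (v / D) * deriv ρ₀ r)
        (2 * (v / D) * deriv ρ₀ r - 2 * iteratedDeriv 2 ρ₀ r)
        (-(v / D) ^ 2 * ρ₀ r + 2 * (v / D) * deriv ρ₀ r - iteratedDeriv 2 ρ₀ r)
        ((v / D) ^ 2 * ρ₀ r - 2 * (v / D) * deriv ρ₀ r + 2 * iteratedDeriv 2 ρ₀ r)
        (-(2 * (v / D) * deriv ρ₀ r) + 2 * iteratedDeriv 2 ρ₀ r)
        ((v / D) ^ 2 * ρ₀ r - 2 * (v / D) * deriv ρ₀ r + iteratedDeriv 2 ρ₀ r)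
        ((v / D) ^ 3 * ρ₀ r - 2 * (v / D) ^ 2 * deriv ρ₀ r + 2 * (v / D) * iteratedDeriv 2 ρ₀ r)
        (-(2 * (v / D) * iteratedDeriv 2 ρ₀ r) + 2 * iteratedDeriv 3 ρ₀ r)
        (2 * (v / D) ^ 2 * deriv ρ₀ r - 4 * (v / D) * iteratedDeriv 2 ρ₀ r +
          2 * iteratedDeriv 3 ρ₀ r)
        (-(v / D) ^ 3 * ρ₀ r + 2 * (v / D) ^ 2 * deriv ρ₀ r -
          2 * (v / D) * iteratedDeriv 2 ρ₀ r + 2 / 3 * iteratedDeriv 3 ρ₀ r) (2 * m') := by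
  unfold LI2
  extract_lets -merge ρ ρr ρrr ρrrr X10 X01 Y110 Y210 Y101 Y201 X120 X220 X111 X211 X102 X202 Y120 Y220
    Y111 Y211 Y102 Y202 X130 X230 X121 X221 X112 X212 X103 X203 Snu Cd Cdd
  change _ = closedCoeff D v β δ (Chat ρ) Cd Cdd X10 X01 Y110 Y101 X120 X111 X102 Y120 Y111 Y102
      X130 X121 X112 X103 (2 * m') +
    ε * closedCoeff D v β δ (Chat ρ) Cd Cdd X10 X01 Y210 Y201 X220 X211 X202 Y220 Y211 Y202
      X230 X221 X212 X203 (2 * m')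
  have hS : ∀ a, Snu a = if a = 0 then (1 : ℝ) else β := fun _ => rfl
  clear_value X10 X01 Y110 Y210 Y101 Y201 X120 X220 X111 X211 X102 X202 Y120 Y220
    Y111 Y211 Y102 Y202 X130 X230 X121 X221 X112 X212 X103 X203 Snu Cd Cdd ρ
  simp only [hS]
  have s1 := sum_choose_even_boundary X10 X01 β ((δ + 1) * Y101 + ε * ((δ + 1) * Y201))
    ((δ - 1) * Y110 + ε * ((δ - 1) * Y210)) 0 m'
  have s2 := sum_choose_odd X10 X01 ((δ - 1) * Y101 + (δ + 1) * Y110 +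
    ε * ((δ - 1) * Y201 + (δ + 1) * Y210)) m'
  have s3 := sum_choose_even_boundary X10 X01 β
    (Cd * (Y102 + ε * Y202) + 1 / 2 * Cdd * (Y101 ^ 2 + ε * Y201 ^ 2))
    (Cd * (Y120 + ε * Y220) + 1 / 2 * Cdd * (Y110 ^ 2 + ε * Y210 ^ 2)) 0 m'
  have s4 := sum_choose_odd X10 X01
    (Cd * (Y111 + ε * Y211) + Cdd * (Y101 * Y110 + ε * (Y201 * Y210))) m'
  have s0 := sum_choose_odd X10 X01 1 m'
  simp only [mul_one, one_mul] at s0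
  have c1 : ∀ p, (δ + 1) * Y101 * (if 2 * p = 0 then (1 : ℝ) else β) +
      (δ - 1) * Y110 * (if 2 * (m' - p) = 0 then (1 : ℝ) else β) +
      ε * ((δ + 1) * Y201 * (if 2 * p = 0 then (1 : ℝ) else β) +
        (δ - 1) * Y210 * (if 2 * (m' - p) = 0 then (1 : ℝ) else β)) =
      ((δ + 1) * Y101 + ε * ((δ + 1) * Y201)) * (if 2 * p = 0 then (1 : ℝ) else β) +
      ((δ - 1) * Y110 + ε * ((δ - 1) * Y210)) *
        (if 2 * (m' - p) = 0 then (1 : ℝ) else β) + 0 := fun p => by ring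
  have c3 : ∀ p, Cd * (Y102 * (if 2 * p = 0 then (1 : ℝ) else β) +
        Y120 * (if 2 * (m' - p) = 0 then (1 : ℝ) else β) +
        ε * (Y202 * (if 2 * p = 0 then (1 : ℝ) else β) +
          Y220 * (if 2 * (m' - p) = 0 then (1 : ℝ) else β))) +
      1 / 2 * Cdd * (Y101 ^ 2 * (if 2 * p = 0 then (1 : ℝ) else β) +
        Y110 ^ 2 * (if 2 * (m' - p) = 0 then (1 : ℝ) else β) +
        ε * (Y201 ^ 2 * (if 2 * p = 0 then (1 : ℝ) else β) +
          Y210 ^ 2 * (if 2 * (m' - p) = 0 then (1 : ℝ) else β))) =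
      (Cd * (Y102 + ε * Y202) + 1 / 2 * Cdd * (Y101 ^ 2 + ε * Y201 ^ 2)) *
        (if 2 * p = 0 then (1 : ℝ) else β) +
      (Cd * (Y120 + ε * Y220) + 1 / 2 * Cdd * (Y110 ^ 2 + ε * Y210 ^ 2)) *
        (if 2 * (m' - p) = 0 then (1 : ℝ) else β) + 0 := fun p => by ring
  simp only [c1, c3]
  rw [s0, s1, s2, s3, s4]
  rcases m' with _ | N
  · simp only [closedCoeff, mul_zero, Nat.cast_zero, zero_mul, zero_div]
    ring
  · have s5 := sum_pred_choose_even_boundary X10 X01 β ((δ + 1) * X102 + ε * ((δ + 1) * X202))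
      (β * (δ - 1) * X111 + β * (δ + 1) * X120 +
        ε * (β * (δ - 1) * X211 + β * (δ + 1) * X220)) N
    have s6 := sum_pred_choose_odd_boundary X10 X01 β
      ((δ - 1) * X120 + ε * ((δ - 1) * X220))
      (β * (δ - 1) * X102 + β * (δ + 1) * X111 +
        ε * (β * (δ - 1) * X202 + β * (δ + 1) * X211)) N
    have s7 := sum_pred_choose_even_boundary X10 X01 β
      (Cd * (X102 * Y101 + ε * (X202 * Y201)) + Chat ρ * (X103 + ε * X203))
      (Cd * (β * X111 * Y110 + β * X120 * Y101 + ε * (β * X211 * Y210 + β * X220 * Y201)) +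
        Chat ρ * (β * X121 + ε * (β * X221))) N
    have s8 := sum_pred_choose_odd_boundary X10 X01 β
      (Cd * (X120 * Y110 + ε * (X220 * Y210)) + Chat ρ * (X130 + ε * X230))
      (Cd * (β * X102 * Y110 + β * X111 * Y101 + ε * (β * X202 * Y210 + β * X211 * Y201)) +
        Chat ρ * (β * X112 + ε * (β * X212))) N
    have s9 := sum_pred_pred_choose_even_boundary X10 X01 β
      (X102 ^ 2 + ε * X202 ^ 2) (X120 ^ 2 + ε * X220 ^ 2)
      (2 * β * X102 * X120 + β * X111 ^ 2 + ε * (2 * β * X202 * X220 + β * X211 ^ 2)) N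
    have s10 := sum_pred_pred_choose_odd X10 X01 (2 * X102 * X111 + 2 * X111 * X120 +
      ε * (2 * X202 * X211 + 2 * X211 * X220)) N
    have c5 : ∀ p, (δ + 1) * X102 * (if 2 * p = 0 then (1 : ℝ) else β) + β * (δ - 1) * X111 + β * (δ + 1) * X120 +
      ε * ((δ + 1) * X202 * (if 2 * p = 0 then (1 : ℝ) else β) + β * (δ - 1) * X211 +
        β * (δ + 1) * X220) =
      ((δ + 1) * X102 + ε * ((δ + 1) * X202)) * (if 2 * p = 0 then (1 : ℝ) else β) +
      (β * (δ - 1) * X111 + β * (δ + 1) * X120 +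
        ε * (β * (δ - 1) * X211 + β * (δ + 1) * X220)) := fun p => by ring
    have c6 : ∀ p, β * (δ - 1) * X102 + β * (δ + 1) * X111 +
      (δ - 1) * X120 * (if 2 * (N + 1 - p - 1) = 0 then (1 : ℝ) else β) +
      ε * (β * (δ - 1) * X202 + β * (δ + 1) * X211 +
        (δ - 1) * X220 * (if 2 * (N + 1 - p - 1) = 0 then (1 : ℝ) else β)) =
      ((δ - 1) * X120 + ε * ((δ - 1) * X220)) * (if 2 * (N + 1 - p - 1) = 0 then (1 : ℝ) else β) +
      (β * (δ - 1) * X102 + β * (δ + 1) * X111 +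
        ε * (β * (δ - 1) * X202 + β * (δ + 1) * X211)) := fun p => by ring
    have c7 : ∀ p, Cd * (X102 * Y101 * (if 2 * p = 0 then (1 : ℝ) else β) + β * X111 * Y110 + β * X120 * Y101 +
        ε * (X202 * Y201 * (if 2 * p = 0 then (1 : ℝ) else β) + β * X211 * Y210 + β * X220 * Y201)) +
      Chat ρ * (X103 * (if 2 * p = 0 then (1 : ℝ) else β) + β * X121 +
        ε * (X203 * (if 2 * p = 0 then (1 : ℝ) else β) + β * X221)) =
      (Cd * (X102 * Y101 + ε * (X202 * Y201)) + Chat ρ * (X103 + ε * X203)) * (if 2 * p = 0 then (1 : ℝ) else β) +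
      (Cd * (β * X111 * Y110 + β * X120 * Y101 + ε * (β * X211 * Y210 + β * X220 * Y201)) +
        Chat ρ * (β * X121 + ε * (β * X221))) := fun p => by ring
    have c8 : ∀ p, Cd * (β * X102 * Y110 + β * X111 * Y101 +
        X120 * Y110 * (if 2 * (N + 1 - p - 1) = 0 then (1 : ℝ) else β) +
        ε * (β * X202 * Y210 + β * X211 * Y201 +
          X220 * Y210 * (if 2 * (N + 1 - p - 1) = 0 then (1 : ℝ) else β))) +
      Chat ρ * (β * X112 + X130 * (if 2 * (N + 1 - p - 1) = 0 then (1 : ℝ) else β) +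
        ε * (β * X212 + X230 * (if 2 * (N + 1 - p - 1) = 0 then (1 : ℝ) else β))) =
      (Cd * (X120 * Y110 + ε * (X220 * Y210)) + Chat ρ * (X130 + ε * X230)) *
        (if 2 * (N + 1 - p - 1) = 0 then (1 : ℝ) else β) +
      (Cd * (β * X102 * Y110 + β * X111 * Y101 + ε * (β * X202 * Y210 + β * X211 * Y201)) +
        Chat ρ * (β * X112 + ε * (β * X212))) := fun p => by ring
    have c9 : ∀ p, X102 ^ 2 * (if 2 * p = 0 then (1 : ℝ) else β) + 2 * β * X102 * X120 + β * X111 ^ 2 +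
      X120 ^ 2 * (if 2 * (N + 1 - p - 1) = 0 then (1 : ℝ) else β) +
      ε * (X202 ^ 2 * (if 2 * p = 0 then (1 : ℝ) else β) + 2 * β * X202 * X220 + β * X211 ^ 2 +
        X220 ^ 2 * (if 2 * (N + 1 - p - 1) = 0 then (1 : ℝ) else β)) =
      (X102 ^ 2 + ε * X202 ^ 2) * (if 2 * p = 0 then (1 : ℝ) else β) +
      (X120 ^ 2 + ε * X220 ^ 2) * (if 2 * (N + 1 - p - 1) = 0 then (1 : ℝ) else β) +
      (2 * β * X102 * X120 + β * X111 ^ 2 + ε * (2 * β * X202 * X220 + β * X211 ^ 2)) := fun p => by ring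
    simp only [c5, c6, c7, c8, c9]
    rw [s5, s6, s7, s8, s9, s10]
    simp only [closedCoeff]
    ring

/-! ### Summation over the two leading trits -/

/-- Second-order coefficient of `h ^ (-m) * f̃(h x, p + h y)`, up to the correction of relative
order `X ^ 2`, in terms of the jets of `x` and `y`. -/
def secondCoeff (m : ℕ) (C₀ C₁ C₂ X₁ X₂ X₃ Y₁ Y₂ : ℝ) : ℝ :=
  X₁ ^ m * (C₁ * Y₂ + C₂ / 2 * Y₁ ^ 2) + m * X₁ ^ (m - 1) * X₂ * (C₁ * Y₁) +
    (m * X₁ ^ (m - 1) * X₃ + m * ((m : ℝ) - 1) * X₁ ^ (m - 2) / 2 * X₂ ^ 2) * C₀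

/-- The displacement `ω - 1 ∈ {-1, 0, 1}` attached to a trit. -/
def trit (ω : Fin 3) : ℝ := ((ω : ℕ) : ℝ) - 1

lemma trit_zero : trit 0 = -1 := by simp [trit]

lemma trit_one : trit 1 = 0 := by simp [trit]

lemma trit_two : trit 2 = 1 := by norm_num [trit]

lemma nu_eq (β P : ℝ) (ω : Fin 3) : nu β P ω = nu β 0 ω * (1 - trit ω * P / 2) := by
  fin_cases ω <;> simp [nu, trit, -mul_eq_mul_left_iff] <;> ring

lemma eta_eq (β P : ℝ) (ω : Fin 3) : eta β P ω = nu β 0 ω * (1 + trit ω * P / 2) := by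
  fin_cases ω <;> simp [nu, eta, trit, -mul_eq_mul_left_iff] <;> ring

/-- First-order coefficient of the weighted local term attached to the leading trits `ω`, `u`. -/
def firstTerm (β δ a C₀ C₁ A B Y10 Y01 X20 X11 X02 : ℝ) (m : ℕ) (ω u : Fin 3) : ℝ :=
  nu β 0 ω * nu β 0 u *
    ((1 + δ) * (((trit ω * A + trit u * B) / 2) ^ m *
          (C₁ * ((trit ω * Y10 + trit u * Y01) / 2)) +
        (m : ℝ) * ((trit ω * A + trit u * B) / 2) ^ (m - 1) *
          ((trit ω ^ 2 * X20 + trit ω * trit u * X11 + trit u ^ 2 * X02) / 4) * C₀) +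
      ((1 - δ) * trit ω - (1 + δ) * trit u) * a / 2 *
        (((trit ω * A + trit u * B) / 2) ^ m * C₀))

/-- Second-order coefficient of the weighted local term attached to the leading trits `ω`, `u`. -/
def secondTerm (β δ a C₀ C₁ C₂ A B Y10 Y01 X20 X11 X02 Y20 Y11 Y02 X30 X21 X12 X03 : ℝ)
    (m : ℕ) (ω u : Fin 3) : ℝ :=
  nu β 0 ω * nu β 0 u *
    ((1 + δ) * secondCoeff m C₀ C₁ C₂ ((trit ω * A + trit u * B) / 2)
        ((trit ω ^ 2 * X20 + trit ω * trit u * X11 + trit u ^ 2 * X02) / 4)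
        ((trit ω ^ 3 * X30 + trit ω ^ 2 * trit u * X21 + trit ω * trit u ^ 2 * X12 +
          trit u ^ 3 * X03) / 8)
        ((trit ω * Y10 + trit u * Y01) / 2)
        ((trit ω ^ 2 * Y20 + trit ω * trit u * Y11 + trit u ^ 2 * Y02) / 4) +
      ((1 - δ) * trit ω - (1 + δ) * trit u) * a / 2 *
        (((trit ω * A + trit u * B) / 2) ^ m *
          (C₁ * ((trit ω * Y10 + trit u * Y01) / 2)) +
        (m : ℝ) * ((trit ω * A + trit u * B) / 2) ^ (m - 1) *
          ((trit ω ^ 2 * X20 + trit ω * trit u * X11 + trit u ^ 2 * X02) / 4) * C₀) -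
      (1 - δ) * trit ω * trit u * a ^ 2 / 4 *
        (((trit ω * A + trit u * B) / 2) ^ m * C₀))

lemma sum_firstTerm_eq_zero (β δ a C₀ C₁ A B Y10 Y01 X20 X11 X02 : ℝ) (m' : ℕ) :
    ∑ ω : Fin 3, ∑ u : Fin 3,
      firstTerm β δ a C₀ C₁ A B Y10 Y01 X20 X11 X02 (2 * m') ω u = 0 := by
  have hneg : ∀ s : ℝ, (-s) ^ (2 * m') = s ^ (2 * m') := (even_two_mul m').neg_pow
  have hneg' : ∀ s : ℝ, ((2 * m' : ℕ) : ℝ) * (-s) ^ (2 * m' - 1) =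
      -(((2 * m' : ℕ) : ℝ) * s ^ (2 * m' - 1)) := fun s => by
    rcases m' with _ | N
    · simp
    · rw [neg_pow_two_mul_sub_one s N.succ_pos]
      ring
  have e1 : (-1 * A + -1 * B) / 2 = -((1 * A + 1 * B) / 2) := by ring
  have e2 : (-1 * A + 1 * B) / 2 = -((1 * A + -1 * B) / 2) := by ring
  have e3 : (-1 * A + 0 * B) / 2 = -((1 * A + 0 * B) / 2) := by ring
  have e4 : (0 * A + -1 * B) / 2 = -((0 * A + 1 * B) / 2) := by ring
  simp only [firstTerm, Fin.sum_univ_three, trit_zero, trit_one, trit_two, nu, e1, e2, e3, e4, hneg, hneg']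
  norm_num
  ring

set_option maxHeartbeats 1000000 in
lemma sum_secondTerm_eq_closedCoeff
    (D a β δ C₀ C₁ C₂ A B Y10 Y01 X20 X11 X02 Y20 Y11 Y02 X30 X21 X12 X03 : ℝ) (m' : ℕ)
    (hD : D ≠ 0) :
    2 * D * ∑ ω : Fin 3, ∑ u : Fin 3,
      secondTerm β δ a C₀ C₁ C₂ A B Y10 Y01 X20 X11 X02 Y20 Y11 Y02 X30 X21 X12 X03
        (2 * m') ω u =
      β * closedCoeff D (a * D) β δ C₀ C₁ C₂ A B Y10 Y01 X20 X11 X02 Y20 Y11 Y02 X30 X21 X12 X03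
        (2 * m') := by
  have hv : (a * D) ^ 2 * C₀ / D = a ^ 2 * D * C₀ := by
    field_simp
  simp only [closedCoeff, secondTerm, hv]
  rcases m' with _ | N
  · simp [Fin.sum_univ_three, trit_zero, trit_one, trit_two, nu, secondCoeff, binomEven, binomOdd]
    ring
  · obtain ⟨Z, hZ⟩ : ∃ Z : ℝ → ℝ, ∀ s, Z s = (s ^ 2) ^ N := ⟨_, fun _ => rfl⟩
    have z0 : ∀ s : ℝ, s ^ (2 * (N + 1) - 2) = Z s := fun s => by
      rw [hZ, ← pow_mul, show 2 * (N + 1) - 2 = 2 * N by omega]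
    have z1 : ∀ s : ℝ, s ^ (2 * (N + 1) - 1) = s * Z s := fun s => by
      rw [hZ, ← pow_mul, show 2 * (N + 1) - 1 = 2 * N + 1 by omega]
      ring
    have z2 : ∀ s : ℝ, s ^ (2 * (N + 1)) = s ^ 2 * Z s := fun s => by
      rw [hZ]
      ring
    have hneg : ∀ s, Z (-s) = Z s := fun s => by simp [hZ]
    have hhalf : ∀ s, Z (s / 2) = Z s / Z 2 := fun s => by simp [hZ, div_pow]
    have e1 : -1 * A + -1 * B = -(A + B) := by ring
    have e2 : -1 * A + 1 * B = -(A - B) := by ring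
    have e3 : -1 * A + 0 * B = -A := by ring
    have e4 : 0 * A + -1 * B = -B := by ring
    have e5 : 1 * A + 1 * B = A + B := by ring
    have e6 : 1 * A + -1 * B = A - B := by ring
    have e7 : 1 * A + 0 * B = A := by ring
    have e8 : 0 * A + 1 * B = B := by ring
    have e9 : 0 * A + 0 * B = 0 := by ring
    have w1 : (2 : ℝ) ^ (2 * (N + 1) + 1) = 8 * Z 2 := by
      rw [pow_add, z2]
      ring
    have w2 : (2 : ℝ) ^ (2 * (N + 1) + 2) = 16 * Z 2 := by
      rw [pow_add, z2]
      ring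
    simp only [Fin.sum_univ_three, trit_zero, trit_one, trit_two, secondCoeff, binomEven, binomOdd,
      e1, e2, e3, e4, e5, e6, e7, e8, e9, z0, z1, z2, w1, w2, hhalf, hneg]
    have n0 : nu β 0 0 = β / 2 := by simp [nu]
    have n1 : nu β 0 1 = 1 - β := by simp [nu]
    have n2 : nu β 0 2 = β / 2 := by simp [nu]
    simp only [n0, n1, n2]
    generalize Z (A + B) = zP
    generalize Z (A - B) = zM
    generalize Z A = zA
    generalize Z B = zB
    generalize Z 2 = z2
    generalize ((2 * (N + 1) : ℕ) : ℝ) = m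
    ring

/-! ### Expansion of the local densities -/

lemma nu_zero_ne_zero {β : ℝ} (hβ0 : 0 < β) (hβ1 : β < 1) (ω : Fin 3) : nu β 0 ω ≠ 0 := by
  fin_cases ω <;> simp [nu] <;> linarith

/-- Expansion of `(η(ω)/ν(ω) - 1) / h` at Péclet number `a h`. -/
lemma quadExp_ratio {β : ℝ} (hβ0 : 0 < β) (hβ1 : β < 1) (a : ℝ) (ω : Fin 3) :
    QuadExp (fun h => (eta β (a * h) ω / nu β (a * h) ω - 1) / h)
      (fun _ => trit ω * a) (fun _ => trit ω ^ 2 * a ^ 2 / 2)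
      (trit ω * a) (trit ω ^ 2 * a ^ 2 / 2) (trit ω ^ 3 * a ^ 3 / 4) := by
  have hden : Tendsto (fun h : ℝ => 1 - trit ω * (a * h) / 2) (nhdsWithin 0 (Set.Ioi 0))
      (nhds 1) := by
    have hc : Continuous fun h : ℝ => 1 - trit ω * (a * h) / 2 := by fun_prop
    simpa using (hc.tendsto 0).mono_left nhdsWithin_le_nhds
  refine ⟨tendsto_const_nhds, tendsto_const_nhds,
    fun h => trit ω ^ 3 * a ^ 3 / 4 / (1 - trit ω * (a * h) / 2), ?_, ?_⟩
  · simpa [Pi.div_def] using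
      (tendsto_const_nhds (x := trit ω ^ 3 * a ^ 3 / 4)).div hden one_ne_zero
  · filter_upwards [self_mem_nhdsWithin, hden.eventually_ne one_ne_zero] with h (hh : 0 < h) hne
    rw [eta_eq, nu_eq β (a * h), mul_div_mul_left _ _ (nu_zero_ne_zero hβ0 hβ1 ω)]
    have hh' := hh.ne'
    have hne' : 2 - trit ω * a * h ≠ 0 := fun h0 => hne (by linear_combination h0 / 2)
    field_simp
    ring

lemma tendsto_ratio {β : ℝ} (hβ0 : 0 < β) (hβ1 : β < 1) (a : ℝ) (ω : Fin 3) :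
    Tendsto (fun h => eta β (a * h) ω / nu β (a * h) ω) (nhdsWithin 0 (Set.Ioi 0)) (nhds 1) := by
  have h := ((QuadExp.const 1).add (quadExp_ratio hβ0 hβ1 a ω).id_mul).tendsto
  rw [add_zero] at h
  refine h.congr' ?_
  filter_upwards [self_mem_nhdsWithin] with x (hx : 0 < x)
  have hx' := hx.ne'
  field_simp
  ring

/-- The `i`-th derivative of the effective density seen by the trit string `u`. -/
def densityJet (β a r : ℝ) (ρ₀ : ℝ → ℝ) {K : ℕ} (u : Fin K → Fin 3) (i : ℕ) (h : ℝ) : ℝ :=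
  (∏ d, eta β (a * h) (u d) / nu β (a * h) (u d)) *
    iteratedDeriv i ρ₀ (r + (∑ d, (1 - ((u d : ℕ) : ℝ))) * h)

lemma tendsto_prod_ratio {β : ℝ} (hβ0 : 0 < β) (hβ1 : β < 1) (a : ℝ) {K : ℕ}
    (u : Fin K → Fin 3) :
    Tendsto (fun h => ∏ d, eta β (a * h) (u d) / nu β (a * h) (u d))
      (nhdsWithin 0 (Set.Ioi 0)) (nhds 1) := by
  simpa using tendsto_finsetProd (Finset.univ : Finset (Fin K)) fun d _ =>
    tendsto_ratio hβ0 hβ1 a (u d)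

lemma tendsto_densityJet {β : ℝ} (hβ0 : 0 < β) (hβ1 : β < 1) (a r : ℝ) {ρ₀ : ℝ → ℝ}
    (hρ : ContDiff ℝ (⊤ : ℕ∞) ρ₀) {K : ℕ} (u : Fin K → Fin 3) (i : ℕ) :
    Tendsto (densityJet β a r ρ₀ u i) (nhdsWithin 0 (Set.Ioi 0))
      (nhds (iteratedDeriv i ρ₀ r)) := by
  have hc : Continuous fun h : ℝ =>
      iteratedDeriv i ρ₀ (r + (∑ d, (1 - ((u d : ℕ) : ℝ))) * h) :=
    (hρ.continuous_iteratedDeriv i (WithTop.coe_le_coe.2 le_top)).comp (by fun_prop)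
  have h2 := (hc.tendsto 0).mono_left (nhdsWithin_le_nhds (s := Set.Ioi 0))
  rw [mul_zero, add_zero] at h2
  have h3 := (tendsto_prod_ratio hβ0 hβ1 a u).mul h2
  rwa [one_mul] at h3

lemma quadExp_rhoHat {β : ℝ} (hβ0 : 0 < β) (hβ1 : β < 1) (a r : ℝ) {ρ₀ : ℝ → ℝ}
    (hρ : ContDiff ℝ (⊤ : ℕ∞) ρ₀) {K : ℕ} (u : Fin K → Fin 3) (j : ℤ) :
    QuadExp (fun h => (rhoHat β (a * h) r h ρ₀ j u - densityJet β a r ρ₀ u 0 h) / h)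
      (fun h => j * densityJet β a r ρ₀ u 1 h)
      (fun h => (j : ℝ) ^ 2 / 2 * densityJet β a r ρ₀ u 2 h)
      (j * iteratedDeriv 1 ρ₀ r) ((j : ℝ) ^ 2 / 2 * iteratedDeriv 2 ρ₀ r)
      ((j : ℝ) ^ 3 / 6 * iteratedDeriv 3 ρ₀ r) := by
  choose ζ hζ hT using fun h : ℝ => exists_taylor_lagrange hρ 2
    (r + (∑ d, (1 - ((u d : ℕ) : ℝ))) * h) (j * h)
  have t1 : Tendsto (fun h : ℝ => r + (∑ d, (1 - ((u d : ℕ) : ℝ))) * h)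
      (nhdsWithin 0 (Set.Ioi 0)) (nhds r) := by
    simpa using (QuadExp.tendsto_id_zero.const_mul (∑ d, (1 - ((u d : ℕ) : ℝ)))).const_add r
  have t2 : Tendsto (fun h : ℝ => (j : ℝ) * h) (nhdsWithin 0 (Set.Ioi 0)) (nhds 0) := by
    simpa using QuadExp.tendsto_id_zero.const_mul (j : ℝ)
  have tζ := tendsto_of_abs_sub_le hζ t1 t2
  have t3 := ((hρ.continuous_iteratedDeriv 3 (WithTop.coe_le_coe.2 le_top)).tendsto r).comp tζ
  refine ⟨(tendsto_densityJet hβ0 hβ1 a r hρ u 1).const_mul _,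
    (tendsto_densityJet hβ0 hβ1 a r hρ u 2).const_mul _,
    fun h => (j : ℝ) ^ 3 / 6 * ((∏ d, eta β (a * h) (u d) / nu β (a * h) (u d)) *
      iteratedDeriv 3 ρ₀ (ζ h)), ?_, ?_⟩
  · simpa using ((tendsto_prod_ratio hβ0 hβ1 a u).mul t3).const_mul ((j : ℝ) ^ 3 / 6)
  · filter_upwards [self_mem_nhdsWithin] with h (hh : 0 < h)
    have hh' := hh.ne'
    have hpos : r + ((j : ℝ) + ∑ d, (1 - ((u d : ℕ) : ℝ))) * h =
      r + (∑ d, (1 - ((u d : ℕ) : ℝ))) * h + j * h := by ring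
    rw [rhoHat, hpos, hT h]
    simp only [densityJet, Finset.sum_range_succ, Finset.sum_range_zero, Nat.factorial]
    generalize (∏ d, eta β (a * h) (u d) / nu β (a * h) (u d)) = q
    field_simp
    push_cast
    ring

/-- Expansion of `(η(ω)/ν(ω) ρ̂ⱼ - ρ̂₀) / h`. -/
lemma quadExp_ratio_mul_rhoHat {β : ℝ} (hβ0 : 0 < β) (hβ1 : β < 1) (a r : ℝ) {ρ₀ : ℝ → ℝ}
    (hρ : ContDiff ℝ (⊤ : ℕ∞) ρ₀) {K : ℕ} (u : Fin K → Fin 3) (ω : Fin 3) (j : ℤ) :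
    QuadExp (fun h => (eta β (a * h) ω / nu β (a * h) ω * rhoHat β (a * h) r h ρ₀ j u -
        densityJet β a r ρ₀ u 0 h) / h)
      (fun h => trit ω * a * densityJet β a r ρ₀ u 0 h + j * densityJet β a r ρ₀ u 1 h)
      (fun h => trit ω ^ 2 * a ^ 2 / 2 * densityJet β a r ρ₀ u 0 h +
        (j : ℝ) ^ 2 / 2 * densityJet β a r ρ₀ u 2 h +
        trit ω * a * j * densityJet β a r ρ₀ u 1 h)
      (trit ω * a * ρ₀ r + j * iteratedDeriv 1 ρ₀ r)
      (trit ω ^ 2 * a ^ 2 / 2 * ρ₀ r + (j : ℝ) ^ 2 / 2 * iteratedDeriv 2 ρ₀ r +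
        trit ω * a * j * iteratedDeriv 1 ρ₀ r)
      (trit ω ^ 3 * a ^ 3 / 4 * ρ₀ r + (j : ℝ) ^ 3 / 6 * iteratedDeriv 3 ρ₀ r +
        (trit ω * a * ((j : ℝ) ^ 2 / 2) * iteratedDeriv 2 ρ₀ r +
          trit ω ^ 2 * a ^ 2 / 2 * j * iteratedDeriv 1 ρ₀ r)) := by
  have hq := quadExp_ratio hβ0 hβ1 a ω
  have hR := quadExp_rhoHat hβ0 hβ1 a r hρ u j
  have hp := QuadExp.of_tendsto (tendsto_densityJet hβ0 hβ1 a r hρ u 0)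
  refine (((hq.mul hp).add hR).add (hq.mul hR).id_mul).of_eq ?_ (fun h => by ring)
    (fun h => by ring) ?_ ?_ ?_
  · filter_upwards [self_mem_nhdsWithin] with h (hh : 0 < h)
    have hh' := hh.ne'
    field_simp
    ring
  all_goals
    rw [iteratedDeriv_zero]
    ring

/-! ### Assembly -/

/-- Expansion of the weight `(η(ω) + δ ν(ω)) ν(u)` at Péclet number `a h`. -/
lemma quadExp_weight (β δ a : ℝ) (ω u : Fin 3) :
    QuadExp (fun h => (eta β (a * h) ω + δ * nu β (a * h) ω) * nu β (a * h) u)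
      (fun _ => nu β 0 ω * nu β 0 u * (1 + δ))
      (fun _ => nu β 0 ω * nu β 0 u * (((1 - δ) * trit ω - (1 + δ) * trit u) * a / 2))
      (nu β 0 ω * nu β 0 u * (1 + δ))
      (nu β 0 ω * nu β 0 u * (((1 - δ) * trit ω - (1 + δ) * trit u) * a / 2))
      (-(nu β 0 ω * nu β 0 u * ((1 - δ) * trit ω * trit u * a ^ 2 / 4))) := by
  refine ⟨tendsto_const_nhds, tendsto_const_nhds, fun _ => _, tendsto_const_nhds,
    Eventually.of_forall fun h => ?_⟩
  rw [eta_eq, nu_eq β (a * h) ω, nu_eq β (a * h) u]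
  ring

/-- Expansion of a weighted local term, for the cell `j = -σ (ω - 1)`, in terms of the
coefficients of the half difference and half sum of the two densities. -/
lemma quadExp_weight_mul_Floc {β : ℝ} (hβ0 : 0 < β) (hβ1 : β < 1) (a r δ : ℝ) {ρ₀ : ℝ → ℝ}
    (hρ : ContDiff ℝ (⊤ : ℕ∞) ρ₀) {K : ℕ} (u' : Fin K → Fin 3) {f : ℝ → ℝ → ℝ}
    (hf : ContDiff ℝ (⊤ : ℕ∞) (Function.uncurry f))
    {m : ℕ} {Chat : ℝ → ℝ} (hm : Even m) (hsym : ∀ x y, f y x = (-1 : ℝ) ^ m * f x y)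
    (hlow : ∀ Y : ℝ, ∀ j < m, iteratedDeriv j (fun X => ftilde f X Y) 0 = 0)
    (hchar : ∀ Y : ℝ, iteratedDeriv m (fun X => ftilde f X Y) 0 = (m.factorial : ℝ) * Chat Y)
    (ω u : Fin 3) (j : ℤ) (σ : ℝ) (hj : (j : ℝ) = -σ * trit ω) :
    ∃ B : ℝ, QuadExp (fun h => (eta β (a * h) ω + δ * nu β (a * h) ω) * nu β (a * h) u *
        ((h ^ m)⁻¹ * Floc β (a * h) r h ρ₀ f j ω u u'))
      (fun h => nu β 0 ω * nu β 0 u * (1 + δ) *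
        (((trit ω * (a * densityJet β a r ρ₀ u' 0 h) + trit u *
          (-a * densityJet β a r ρ₀ u' 0 h + densityJet β a r ρ₀ u' 1 h)) / 2) ^ m *
          Chat (densityJet β a r ρ₀ u' 0 h)))
      (fun h => firstTerm β δ a (Chat (densityJet β a r ρ₀ u' 0 h))
        (deriv Chat (densityJet β a r ρ₀ u' 0 h))
        (a * densityJet β a r ρ₀ u' 0 h)
        (-a * densityJet β a r ρ₀ u' 0 h + densityJet β a r ρ₀ u' 1 h)
        (a * densityJet β a r ρ₀ u' 0 h - 2 * σ * densityJet β a r ρ₀ u' 1 h)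
        (a * densityJet β a r ρ₀ u' 0 h - densityJet β a r ρ₀ u' 1 h)
        (a ^ 2 * densityJet β a r ρ₀ u' 0 h - 2 * σ * a * densityJet β a r ρ₀ u' 1 h)
        (2 * σ * a * densityJet β a r ρ₀ u' 1 h - 2 * σ * densityJet β a r ρ₀ u' 2 h)
        (-a ^ 2 * densityJet β a r ρ₀ u' 0 h + 2 * a * densityJet β a r ρ₀ u' 1 h -
          densityJet β a r ρ₀ u' 2 h) m ω u)
      (nu β 0 ω * nu β 0 u * (1 + δ) *
        (((trit ω * (a * ρ₀ r) + trit u * (-a * ρ₀ r + deriv ρ₀ r)) / 2) ^ m * Chat (ρ₀ r)))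
      B
      (secondTerm β δ a (Chat (ρ₀ r)) (deriv Chat (ρ₀ r)) (iteratedDeriv 2 Chat (ρ₀ r))
        (a * ρ₀ r) (-a * ρ₀ r + deriv ρ₀ r)
        (a * ρ₀ r - 2 * σ * deriv ρ₀ r) (a * ρ₀ r - deriv ρ₀ r)
        (a ^ 2 * ρ₀ r - 2 * σ * a * deriv ρ₀ r)
        (2 * σ * a * deriv ρ₀ r - 2 * σ * iteratedDeriv 2 ρ₀ r)
        (-a ^ 2 * ρ₀ r + 2 * a * deriv ρ₀ r - iteratedDeriv 2 ρ₀ r)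
        (a ^ 2 * ρ₀ r - 2 * σ * a * deriv ρ₀ r + 2 * σ ^ 2 * iteratedDeriv 2 ρ₀ r)
        (-(2 * σ * a * deriv ρ₀ r) + 2 * σ * iteratedDeriv 2 ρ₀ r)
        (a ^ 2 * ρ₀ r - 2 * a * deriv ρ₀ r + iteratedDeriv 2 ρ₀ r)
        (a ^ 3 * ρ₀ r - 2 * σ * a ^ 2 * deriv ρ₀ r + 2 * σ ^ 2 * a * iteratedDeriv 2 ρ₀ r)
        (-(2 * σ ^ 2 * a * iteratedDeriv 2 ρ₀ r) + 2 * σ ^ 2 * iteratedDeriv 3 ρ₀ r)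
        (2 * σ * a ^ 2 * deriv ρ₀ r - 4 * σ * a * iteratedDeriv 2 ρ₀ r +
          2 * σ * iteratedDeriv 3 ρ₀ r)
        (-a ^ 3 * ρ₀ r + 2 * a ^ 2 * deriv ρ₀ r - 2 * a * iteratedDeriv 2 ρ₀ r +
          2 / 3 * iteratedDeriv 3 ρ₀ r) m ω u +
        (1 + δ) * (nu β 0 ω * nu β 0 u *
          (iteratedDeriv (m + 2) (fun X => ftilde f X (ρ₀ r)) 0 / ((m + 2).factorial : ℝ) *
            ((trit ω * (a * ρ₀ r) + trit u * (-a * ρ₀ r + deriv ρ₀ r)) / 2) ^ (m + 2)))) := by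
  have hU := quadExp_ratio_mul_rhoHat hβ0 hβ1 a r hρ u' ω j
  have hV := quadExp_ratio_mul_rhoHat hβ0 hβ1 a r hρ u' u (j + 1 - ((u : ℕ) : ℤ))
  have hj' : ((j + 1 - ((u : ℕ) : ℤ) : ℤ) : ℝ) = -σ * trit ω - trit u := by
    push_cast
    rw [hj, trit, trit]
    ring
  rw [hj'] at hV
  rw [hj] at hU
  have hx : QuadExp _
      (fun h => (trit ω * (a * densityJet β a r ρ₀ u' 0 h) + trit u *
        (-a * densityJet β a r ρ₀ u' 0 h + densityJet β a r ρ₀ u' 1 h)) / 2)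
      (fun h => (trit ω ^ 2 *
          (a ^ 2 * densityJet β a r ρ₀ u' 0 h - 2 * σ * a * densityJet β a r ρ₀ u' 1 h) +
        trit ω * trit u *
          (2 * σ * a * densityJet β a r ρ₀ u' 1 h - 2 * σ * densityJet β a r ρ₀ u' 2 h) +
        trit u ^ 2 * (-a ^ 2 * densityJet β a r ρ₀ u' 0 h +
          2 * a * densityJet β a r ρ₀ u' 1 h - densityJet β a r ρ₀ u' 2 h)) / 4)
      ((trit ω * (a * ρ₀ r) + trit u * (-a * ρ₀ r + deriv ρ₀ r)) / 2)
      ((trit ω ^ 2 * (a ^ 2 * ρ₀ r - 2 * σ * a * deriv ρ₀ r) +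
        trit ω * trit u * (2 * σ * a * deriv ρ₀ r - 2 * σ * iteratedDeriv 2 ρ₀ r) +
        trit u ^ 2 * (-a ^ 2 * ρ₀ r + 2 * a * deriv ρ₀ r - iteratedDeriv 2 ρ₀ r)) / 4)
      ((trit ω ^ 3 * (a ^ 3 * ρ₀ r - 2 * σ * a ^ 2 * deriv ρ₀ r +
          2 * σ ^ 2 * a * iteratedDeriv 2 ρ₀ r) +
        trit ω ^ 2 * trit u *
          (-(2 * σ ^ 2 * a * iteratedDeriv 2 ρ₀ r) + 2 * σ ^ 2 * iteratedDeriv 3 ρ₀ r) +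
        trit ω * trit u ^ 2 * (2 * σ * a ^ 2 * deriv ρ₀ r -
          4 * σ * a * iteratedDeriv 2 ρ₀ r + 2 * σ * iteratedDeriv 3 ρ₀ r) +
        trit u ^ 3 * (-a ^ 3 * ρ₀ r + 2 * a ^ 2 * deriv ρ₀ r -
          2 * a * iteratedDeriv 2 ρ₀ r + 2 / 3 * iteratedDeriv 3 ρ₀ r)) / 8) :=
    ((hU.add (hV.const_mul (-1))).const_mul (1 / 2)).of_eq (Eventually.of_forall fun _ => rfl)
      (fun h => by ring) (fun h => by ring) (by rw [iteratedDeriv_one]; ring)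
      (by rw [iteratedDeriv_one]; ring) (by rw [iteratedDeriv_one]; ring)
  have hy : QuadExp _
      (fun h => (trit ω *
          (a * densityJet β a r ρ₀ u' 0 h - 2 * σ * densityJet β a r ρ₀ u' 1 h) +
        trit u * (a * densityJet β a r ρ₀ u' 0 h - densityJet β a r ρ₀ u' 1 h)) / 2)
      _
      ((trit ω * (a * ρ₀ r - 2 * σ * deriv ρ₀ r) + trit u * (a * ρ₀ r - deriv ρ₀ r)) / 2)
      ((trit ω ^ 2 *
          (a ^ 2 * ρ₀ r - 2 * σ * a * deriv ρ₀ r + 2 * σ ^ 2 * iteratedDeriv 2 ρ₀ r) +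
        trit ω * trit u * (-(2 * σ * a * deriv ρ₀ r) + 2 * σ * iteratedDeriv 2 ρ₀ r) +
        trit u ^ 2 * (a ^ 2 * ρ₀ r - 2 * a * deriv ρ₀ r + iteratedDeriv 2 ρ₀ r)) / 4)
      _ :=
    ((hU.add hV).const_mul (1 / 2)).of_eq (Eventually.of_forall fun _ => rfl)
      (fun h => by ring) (fun _ => rfl) (by rw [iteratedDeriv_one]; ring)
      (by rw [iteratedDeriv_one]; ring) rfl
  have hp := tendsto_densityJet hβ0 hβ1 a r hρ u' 0
  rw [iteratedDeriv_zero] at hp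
  have hF := (quadExp_weight β δ a ω u).mul
    (QuadExp.ftilde_div_pow hf hm hsym hlow hchar hp hx hy)
  refine ⟨_, hF.of_eq ?_ (fun h => rfl) (fun h => ?_) rfl rfl ?_⟩
  · filter_upwards [self_mem_nhdsWithin] with h (hh : 0 < h)
    have hh' := hh.ne'
    rw [Floc, ftilde]
    congr 3 <;> field_simp <;> ring
  · rw [firstTerm]
    ring
  · rw [secondTerm, secondCoeff]
    ring

/-- The second-order limit of the sum over the two leading trits, for a fixed tail of the string. -/
lemma tendsto_sum_weight_mul_Floc {D β : ℝ} (hD : D ≠ 0) (hβ0 : 0 < β) (hβ1 : β < 1)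
    (a r : ℝ) {ε δ : ℝ} (hεδ : (1 + ε) * (1 + δ) = 0) {ρ₀ : ℝ → ℝ}
    (hρ : ContDiff ℝ (⊤ : ℕ∞) ρ₀) {K : ℕ} (u' : Fin K → Fin 3) {f : ℝ → ℝ → ℝ}
    (hf : ContDiff ℝ (⊤ : ℕ∞) (Function.uncurry f)) {m' : ℕ} {Chat : ℝ → ℝ}
    (hsym : ∀ x y, f y x = (-1 : ℝ) ^ (2 * m') * f x y)
    (hlow : ∀ Y : ℝ, ∀ j < 2 * m', iteratedDeriv j (fun X => ftilde f X Y) 0 = 0)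
    (hchar : ∀ Y : ℝ, iteratedDeriv (2 * m') (fun X => ftilde f X Y) 0 =
      ((2 * m').factorial : ℝ) * Chat Y) :
    Tendsto (fun h => (∑ ω : Fin 3, ∑ u : Fin 3,
        (eta β (a * h) ω + δ * nu β (a * h) ω) * nu β (a * h) u *
          ((h ^ (2 * m'))⁻¹ * (Floc β (a * h) r h ρ₀ f 0 ω u u' +
            ε * Floc β (a * h) r h ρ₀ f (1 - ((ω : ℕ) : ℤ)) ω u u'))) / h ^ 2)
      (nhdsWithin 0 (Set.Ioi 0))
      (nhds (β / (2 * D) * LI2 D (a * D) β r ρ₀ Chat ε δ (2 * m') m')) := by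
  choose B₁ h₁ using fun ω u : Fin 3 => quadExp_weight_mul_Floc hβ0 hβ1 a r δ hρ u' hf
    (even_two_mul m') hsym hlow hchar ω u 0 0 (by simp)
  choose B₂ h₂ using fun ω u : Fin 3 => quadExp_weight_mul_Floc hβ0 hβ1 a r δ hρ u' hf
    (even_two_mul m') hsym hlow hchar ω u (1 - ((ω : ℕ) : ℤ)) 1 (by
      push_cast
      rw [trit]
      ring)
  have hS := QuadExp.sum Finset.univ fun ω _ => QuadExp.sum Finset.univ fun u _ =>
    (h₁ ω u).add ((h₂ ω u).const_mul ε)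
  have ht := hS.tendsto_div_sq (fun h => ?_) (fun h => ?_)
  · convert ht using 2
    · congr 1
      refine Finset.sum_congr rfl fun ω _ => Finset.sum_congr rfl fun u _ => ?_
      ring
    · have hG : ∀ s₁ s₂ g : ℝ, s₁ + (1 + δ) * g + ε * (s₂ + (1 + δ) * g) = s₁ + ε * s₂ :=
        fun s₁ s₂ g => by linear_combination g * hεδ
      simp only [hG, Finset.sum_add_distrib, ← Finset.mul_sum]
      rw [LI2_eq_closedCoeff, mul_div_cancel_right₀ a hD, div_mul_eq_mul_div, mul_add,
        mul_left_comm β ε, ← sum_secondTerm_eq_closedCoeff _ _ _ _ _ _ _ _ _ _ _ _ _ _ _ _ _ _ _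
          _ _ _ hD, ← sum_secondTerm_eq_closedCoeff _ _ _ _ _ _ _ _ _ _ _ _ _ _ _ _ _ _ _
          _ _ _ hD]
      rw [div_eq_iff (mul_ne_zero two_ne_zero hD)]
      ring_nf
  · refine Finset.sum_eq_zero fun ω _ => Finset.sum_eq_zero fun u _ => ?_
    have hG : ∀ n g : ℝ, n * (1 + δ) * g + ε * (n * (1 + δ) * g) = 0 :=
      fun n g => by linear_combination n * g * hεδ
    exact hG _ _
  · simp only [Finset.sum_add_distrib, ← Finset.mul_sum, sum_firstTerm_eq_zero, mul_zero, add_zero]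

lemma sum_prod_nu (β P : ℝ) (K : ℕ) : ∑ u : Fin K → Fin 3, ∏ d, nu β P (u d) = 1 := by
  rw [← Fintype.sum_pow, Fin.sum_univ_three]
  simp only [nu]
  norm_num
  ring_nf

lemma continuous_nu (β : ℝ) (ω : Fin 3) : Continuous fun P => nu β P ω := by
  unfold nu
  split_ifs <;> fun_prop

/-- Leading-order form, Case I-2: if m = 2m′ is even (m′ ≥ 0) and (ε,δ) ≠ (1,1),
then lim_{Δr→0⁺} Δr^(−m)·⟨A⟩(Δr) = L as given by `LI2`. -/
theorem leading_form_I2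
    (D v β r : ℝ) (k : ℕ) (ρ₀ : ℝ → ℝ) (f : ℝ → ℝ → ℝ)
    (ε δ : ℝ) (m : ℕ) (Chat : ℝ → ℝ)
    (hD : 0 < D) (hβ0 : 0 < β) (hβ1 : β < 1) (hk : 1 ≤ k)
    (hρ : ContDiff ℝ (⊤ : ℕ∞) ρ₀) (hρpos : ∀ x, 0 < ρ₀ x)
    (hf : ContDiff ℝ (⊤ : ℕ∞) (Function.uncurry f))
    (hε : ε = 1 ∨ ε = -1) (hδ : δ = 1 ∨ δ = -1)
    (hsym : ∀ x y, f y x = (-1 : ℝ) ^ m * f x y)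
    (hlow : ∀ Y : ℝ, ∀ j < m, iteratedDeriv j (fun X => ftilde f X Y) 0 = 0)
    (hchar : ∀ Y : ℝ, iteratedDeriv m (fun X => ftilde f X Y) 0 = (m.factorial : ℝ) * Chat Y)
    (hCbdd : ∃ M : ℝ, ∀ y, |Chat y| ≤ M) (hCne : ∀ y, Chat y ≠ 0)
    (m' : ℕ) (hm : m = 2 * m') (hne : ¬(ε = 1 ∧ δ = 1)) :
    Filter.Tendsto
      (fun Δr : ℝ => Δr ^ (-(m : ℤ)) * avgA D v β r k ρ₀ f ε δ m Δr)
      (nhdsWithin 0 (Set.Ioi 0)) (nhds (LI2 D v β r ρ₀ Chat ε δ m m')) := by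
  subst hm
  obtain ⟨a, rfl⟩ : ∃ a, v = a * D := ⟨v / D, (div_mul_cancel₀ v hD.ne').symm⟩
  have hεδ : (1 + ε) * (1 + δ) = 0 := by
    rcases hε with rfl | rfl <;> rcases hδ with rfl | rfl <;> simp_all
  have hprod : ∀ u' : Fin (k - 1) → Fin 3,
      Tendsto (fun h : ℝ => ∏ d, nu β (a * h) (u' d)) (nhdsWithin 0 (Set.Ioi 0))
        (nhds (∏ d, nu β 0 (u' d))) := fun u' => tendsto_finsetProd _ fun d _ => by
    have hc := ((continuous_nu β (u' d)).comp (continuous_const_mul a)).tendsto 0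
    simpa [Function.comp_def] using hc.mono_left nhdsWithin_le_nhds
  have hlim := (tendsto_finsetSum (Finset.univ : Finset (Fin (k - 1) → Fin 3)) fun u' _ =>
    (hprod u').mul (tendsto_sum_weight_mul_Floc hD.ne' hβ0 hβ1 a r hεδ hρ u' hf hsym hlow
      hchar)).const_mul (2 * D / β)
  rw [← Finset.sum_mul, sum_prod_nu, one_mul, ← mul_assoc,
    div_mul_div_cancel₀ hβ0.ne', div_self (mul_ne_zero two_ne_zero hD.ne'), one_mul] at hlim
  refine hlim.congr' ?_
  filter_upwards [self_mem_nhdsWithin] with h (hh : 0 < h)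
  have hP : a * D * h / D = a * h := by
    field_simp
  have hsign : (-1 : ℝ) ^ (2 * m') = 1 := (even_two_mul m').neg_one_pow
  rw [avgA, Ksum, hP, hsign, zpow_neg, zpow_natCast]
  simp only [Finset.mul_sum, Finset.sum_div, mul_one]
  rw [Finset.sum_comm]
  refine Finset.sum_congr rfl fun ω _ => ?_
  rw [Finset.sum_comm]
  refine Finset.sum_congr rfl fun u _ => Finset.sum_congr rfl fun u' _ => ?_
  have hh' := hh.ne'
  field_simp
end
end
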